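/- arXiv:2506.14960 — 3 statements merged into one kernel-verified Lean document; each statement's English description precedes it below -/
import Mathlib

section
/- Let n ≥ 2, let U ⊆ ℝⁿ be open, and let smooth functions a_{ik} : U → ℝ and b_{ijm} : U → ℝ with b_{ijm} = −b_{jim} satisfy, for all i, j, l, m: ∂_l a_{im} − ∂_m a_{il} = Σ_j (a_{jl} b_{jim} − a_{jm} b_{jil}) and ∂_l b_{ijm} − ∂_m b_{ijl} = Σ_k (b_{ikl} b_{kjm} − b_{ikm} b_{kjl}) + a_{il} a_{jm} − a_{im} a_{jl}; assume moreover that the matrix (a_{ik}(x)) is invertible for every x ∈ U. Then for every x⁰ ∈ U and every orthogonal matrix L⁰ (L⁰ (L⁰)ᵀ = I) there exist an open neighborhood V ⊆ U of x⁰ and a smooth map L : V → Matrix (n×n, ℝ) with L(x⁰) = L⁰ and L(x) L(x)ᵀ = I for all x ∈ V, such that for every coordinate index m: Σ_k (∂_m L_{1k}) L_{ik} + Σ_{k,l} L_{1k} b_{klm} L_{il} + Σ_k L_{ik} a_{km} = 0 for every i ≠ 1, and Σ_k (∂_m L_{ik}) L_{jk} + Σ_{k,l} L_{ik} b_{klm}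 L_{jl} = 0 for all distinct i, j with i ≠ 1, j ≠ 1; moreover any two such maps defined on a connected open neighborhood of x⁰ and agreeing at x⁰ coincide. -/
open Real Matrix

/-- Partial derivative of `f : ℝⁿ → ℝ` in the `m`-th coordinate direction. -/
noncomputable def pd {n : ℕ} (m : Fin n) (f : (Fin n → ℝ) → ℝ) (x : Fin n → ℝ) : ℝ :=
  fderiv ℝ f x (Pi.single m 1)

/-- `L` is a smooth orthogonal solution on `V` of the frame system
`(dL Lᵗ)₁ᵢ + (L W Lᵗ)₁ᵢ + Σₖ Lᵢₖ ωₖ = 0` (`i ≥ 2`) and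
`(dL Lᵗ)ᵢⱼ + (L W Lᵗ)ᵢⱼ = 0` (`i, j ≥ 2`, `i ≠ j`), written coefficientwise. -/
def FrameSol {n : ℕ} [NeZero n]
    (a : (Fin n → ℝ) → Fin n → Fin n → ℝ)
    (b : (Fin n → ℝ) → Fin n → Fin n → Fin n → ℝ)
    (L : (Fin n → ℝ) → Matrix (Fin n) (Fin n) ℝ)
    (V : Set (Fin n → ℝ)) : Prop :=
  (∀ i k, ContDiffOn ℝ (⊤ : ℕ∞) (fun x => L x i k) V) ∧
  (∀ x ∈ V, L x * (L x)ᵀ = 1) ∧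
  (∀ x ∈ V, ∀ m : Fin n, ∀ i : Fin n, i ≠ 0 →
    (∑ k, pd m (fun y => L y 0 k) x * L x i k)
      + (∑ k, ∑ l, L x 0 k * b x k l m * L x i l)
      + (∑ k, L x i k * a x k m) = 0) ∧
  (∀ x ∈ V, ∀ m : Fin n, ∀ i j : Fin n, i ≠ j → i ≠ 0 → j ≠ 0 →
    (∑ k, pd m (fun y => L y i k) x * L x j k)
      + (∑ k, ∑ l, L x i k * b x k l m * L x j l) = 0)

section frob
open Set Metric Topology Asymptotics
open scoped NNReal

theorem fr_picard {E : Type*} [NormedAddCommGroup E] [NormedSpace ℝ E] [CompleteSpace E]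
    {f : ℝ → E → E} {tmin tmax : ℝ} {t₀ : Icc tmin tmax} {x₀ x : E} {a r L K : ℝ≥0}
    (hf : IsPicardLindelof f t₀ x₀ a r L K) (hx : x ∈ closedBall x₀ r) :
    ∃ α : ℝ → E, α t₀ = x ∧ (∀ t, α t ∈ closedBall x₀ a) ∧
      ∀ t ∈ Icc tmin tmax, HasDerivWithinAt α (f t (α t)) (Icc tmin tmax) t := by
  obtain ⟨α, hα⟩ := ODE.FunSpace.exists_isFixedPt_next hf hx
  refine ⟨α.compProj, by rw [ODE.FunSpace.compProj_val, ← hα, ODE.FunSpace.next_apply₀],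
    fun t => α.compProj_mem_closedBall hf.mul_max_le, fun t ht ↦ ?_⟩
  apply ODE.hasDerivWithinAt_picard_Icc t₀.2 hf.continuousOn_uncurry
    α.continuous_compProj.continuousOn (fun _ ht' ↦ α.compProj_mem_closedBall hf.mul_max_le)
    x ht |>.congr_of_mem _ ht
  intro t' ht'
  nth_rw 1 [← hα]
  rw [ODE.FunSpace.compProj_of_mem ht', ODE.FunSpace.next_apply]

variable {X E : Type*} [NormedAddCommGroup X] [NormedSpace ℝ X]
  [NormedAddCommGroup E] [NormedSpace ℝ E]

theorem fr_core [CompleteSpace E] (f : X × E → X →L[ℝ] E) (x0 : X) (y0 : E) (δ C : ℝ) (K : ℝ≥0)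
    (hδ : 0 < δ) (hC : 0 < C)
    (hd : ∀ p ∈ closedBall (x0, y0) (2 * δ), DifferentiableAt ℝ f p)
    (hb : ∀ p ∈ closedBall (x0, y0) (2 * δ), ‖f p‖ ≤ C)
    (hb' : ∀ p ∈ closedBall (x0, y0) (2 * δ), ‖fderiv ℝ f p‖ ≤ C)
    (hK : LipschitzOnWith K (fderiv ℝ f) (closedBall (x0, y0) (2 * δ)))
    (hcomp : ∀ p ∈ closedBall (x0, y0) (2 * δ), ∀ h k : X,
      fderiv ℝ f p (h, f p h) k = fderiv ℝ f p (k, f p k) h) :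
    ∃ r > 0, ∃ Y : X → E, Y x0 = y0 ∧ ∀ x ∈ ball x0 r, HasFDerivAt Y (f (x, Y x)) x := by
  have hmem : ∀ x y, (x, y) ∈ closedBall (x0, y0) (2 * δ) ↔
      ‖x - x0‖ ≤ 2 * δ ∧ ‖y - y0‖ ≤ 2 * δ := by
    intro x y
    rw [mem_closedBall, Prod.dist_eq, max_le_iff, dist_eq_norm, dist_eq_norm]
  have hconv : Convex ℝ (closedBall (x0, y0) (2 * δ)) := convex_closedBall _ _
  have hlip : ∀ p ∈ closedBall (x0, y0) (2 * δ), ∀ q ∈ closedBall (x0, y0) (2 * δ),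
      ‖f q - f p‖ ≤ C * ‖q - p‖ := fun p hp q hq =>
    hconv.norm_image_sub_le_of_norm_fderiv_le hd hb' hp hq
  obtain ⟨r, hr, hrδ, hrC⟩ : ∃ r > 0, r ≤ δ ∧ C * r ≤ δ := by
    refine ⟨min δ (δ / C), by positivity, min_le_left _ _, ?_⟩
    calc C * min δ (δ / C) ≤ C * (δ / C) := by gcongr; exact min_le_right _ _
      _ = δ := by field_simp
  have hseg : ∀ z : X, ‖z‖ < r → ∀ t ∈ Icc (0:ℝ) 1, ‖x0 + t • z - x0‖ ≤ δ := by
    intro z hz t ht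
    rw [add_sub_cancel_left, norm_smul, Real.norm_eq_abs, abs_of_nonneg ht.1]
    nlinarith [norm_nonneg z, ht.1, ht.2]
  have hglip : ∀ z : X, ‖z‖ < r → ∀ t ∈ Icc (0:ℝ) 1,
      LipschitzOnWith (C * r).toNNReal (fun y => f (x0 + t • z, y) z) (closedBall y0 (2 * δ)) := by
    intro z hz t ht
    apply LipschitzOnWith.of_dist_le_mul
    intro y hy y' hy'
    rw [Real.coe_toNNReal _ (by positivity), dist_eq_norm, dist_eq_norm,
      ← _root_.sub_apply]
    rw [mem_closedBall, dist_eq_norm] at hy hy'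
    have h1 := hlip (x0 + t • z, y') ((hmem _ _).2 ⟨by linarith [hseg z hz t ht], hy'⟩)
      (x0 + t • z, y) ((hmem _ _).2 ⟨by linarith [hseg z hz t ht], hy⟩)
    have h2 : ‖((x0 + t • z, y) - (x0 + t • z, y') : X × E)‖ = ‖y - y'‖ := by
      simp [Prod.norm_def]
    rw [h2] at h1
    calc _ ≤ ‖f (x0 + t • z, y) - f (x0 + t • z, y')‖ * ‖z‖ := ContinuousLinearMap.le_opNorm _ _
      _ ≤ (C * ‖y - y'‖) * r := by gcongr
      _ = _ := by ring
  have hex : ∀ z : X, ∃ α : ℝ → E, ‖z‖ < r → (α 0 = y0 ∧ (∀ t, ‖α t - y0‖ ≤ δ) ∧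
      ∀ t ∈ Icc (0:ℝ) 1, HasDerivWithinAt α (f (x0 + t • z, α t) z) (Icc 0 1) t) := by
    intro z
    by_cases hz : ‖z‖ < r
    swap
    · exact ⟨0, fun h => absurd h hz⟩
    have hP : IsPicardLindelof (fun t y => f (x0 + t • z, y) z)
        (⟨0, by simp⟩ : Icc (0:ℝ) 1) y0 δ.toNNReal 0 (C * r).toNNReal (C * r).toNNReal := by
      have e1 : ((δ.toNNReal : ℝ≥0) : ℝ) = δ := Real.coe_toNNReal _ hδ.le
      have e2 : (((C * r).toNNReal : ℝ≥0) : ℝ) = C * r := Real.coe_toNNReal _ (by positivity)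
      constructor
      · intro t ht
        refine (hglip z hz t ht).mono (closedBall_subset_closedBall ?_)
        rw [e1]; linarith
      · intro y hy t ht
        rw [e1, mem_closedBall, dist_eq_norm] at hy
        apply ContinuousAt.continuousWithinAt
        have h0 : ContinuousAt f (x0 + t • z, y) := (hd _ ((hmem _ _).2
          ⟨by linarith [hseg z hz t ht], by linarith⟩)).continuousAt
        have h1 : ContinuousAt (fun s : ℝ => f (x0 + s • z, y)) t :=
          ContinuousAt.comp (f := fun s : ℝ => (x0 + s • z, y)) h0 (by fun_prop)
        exact h1.clm_apply continuousAt_const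
      · intro t ht y hy
        rw [e1, mem_closedBall, dist_eq_norm] at hy
        rw [e2]
        calc _ ≤ ‖f (x0 + t • z, y)‖ * ‖z‖ := ContinuousLinearMap.le_opNorm _ _
          _ ≤ C * r := by
            gcongr
            exact hb _ ((hmem _ _).2 ⟨by linarith [hseg z hz t ht], by linarith⟩)
      · rw [e1, e2]; simpa using hrC
    obtain ⟨α, h1, h2, h3⟩ := fr_picard hP (mem_closedBall_self (by simp))
    refine ⟨α, fun _ => ⟨h1, fun t => ?_, h3⟩⟩
    have := h2 t
    rwa [Real.coe_toNNReal _ hδ.le, mem_closedBall, dist_eq_norm] at this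
  choose α hα using hex
  have hα0 : α 0 1 = y0 := by
    obtain ⟨h1, h2, h3⟩ := hα 0 (by simpa using hr)
    rw [← h1]
    refine (constant_of_has_deriv_right_zero (f := α 0) (a := 0) (b := 1)
      (fun t ht => (h3 t ht).continuousWithinAt) ?_) 1 (by simp)
    intro t ht
    have := (h3 t ⟨ht.1, ht.2.le⟩)
    simp only [map_zero] at this
    exact this.mono_of_mem_nhdsWithin (Icc_mem_nhdsGE_of_mem ht)
  refine ⟨r, hr, fun x => α (x - x0) 1, by simpa using hα0, ?_⟩
  intro x hx
  obtain ⟨z, rfl⟩ : ∃ z, x = x0 + z := ⟨x - x0, by abel⟩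
  rw [mem_ball, dist_eq_norm, add_sub_cancel_left] at hx
  obtain ⟨hy0, hyb, hyd⟩ := hα z hx
  set y := α z with hydef
  set B : ℝ := K * (1 + C) ^ 2 * r + C * (1 + C) with hB
  have hB0 : 0 ≤ B := by positivity
  have key : ∀ h : X, ‖z + h‖ < r → C * ‖h‖ ≤ δ →
      ‖α (z + h) 1 - y 1 - f (x0 + z, y 1) h‖ ≤
        (B / (C * r) * (Real.exp (C * r) - 1)) * ‖h‖ ^ 2 := by
    intro h hzh hh
    obtain ⟨hu0, hub, hud⟩ := hα (z + h) hzh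
    set u := α (z + h) with hudef
    have hp : ∀ t ∈ Icc (0:ℝ) 1, (x0 + t • z, y t) ∈ closedBall (x0, y0) (2 * δ) := fun t ht =>
      (hmem _ _).2 ⟨by linarith [hseg z hx t ht], by linarith [hyb t]⟩
    have hfh : ∀ t ∈ Icc (0:ℝ) 1, ‖f (x0 + t • z, y t) h‖ ≤ C * ‖h‖ := fun t ht =>
      (ContinuousLinearMap.le_opNorm _ _).trans (by gcongr; exact hb _ (hp t ht))
    set v : ℝ → E := fun t => y t + t • f (x0 + t • z, y t) h with hv
    have hvb : ∀ t ∈ Icc (0:ℝ) 1, ‖v t - y0‖ ≤ 2 * δ := by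
      intro t ht
      have : ‖t • f (x0 + t • z, y t) h‖ ≤ δ := by
        rw [norm_smul, Real.norm_eq_abs, abs_of_nonneg ht.1]
        have := hfh t ht
        nlinarith [ht.1, ht.2, norm_nonneg (f (x0 + t • z, y t) h)]
      calc ‖v t - y0‖ = ‖(y t - y0) + t • f (x0 + t • z, y t) h‖ := by simp only [hv]; congr 1; abel
        _ ≤ _ := norm_add_le _ _
        _ ≤ _ := by linarith [hyb t]
    have hvd : ∀ t ∈ Icc (0:ℝ) 1, HasDerivWithinAt v
        (f (x0 + t • z, y t) z + (f (x0 + t • z, y t) h + t •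
          (fderiv ℝ f (x0 + t • z, y t) (z, f (x0 + t • z, y t) z)) h)) (Icc 0 1) t := by
      intro t ht
      have h1 : HasDerivWithinAt (fun s : ℝ => (x0 + s • z, y s)) (z, f (x0 + t • z, y t) z)
          (Icc 0 1) t := by
        refine HasDerivWithinAt.prodMk ?_ (hyd t ht)
        simpa using (((hasDerivAt_id t).smul_const z).const_add x0).hasDerivWithinAt
      have h2 := (hd _ (hp t ht)).hasFDerivAt.comp_hasDerivWithinAt t h1
      have h3 : HasDerivWithinAt (fun s : ℝ => f (x0 + s • z, y s) h)
          ((fderiv ℝ f (x0 + t • z, y t) (z, f (x0 + t • z, y t) z)) h) (Icc 0 1) t := by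
        simpa using h2.clm_apply (hasDerivWithinAt_const t (Icc 0 1) h)
      have h4 := (hasDerivWithinAt_id t (Icc (0:ℝ) 1)).smul h3
      have h5 := (hyd t ht).add h4
      have h6 := h5.congr_deriv (g' := f (x0 + t • z, y t) z + (f (x0 + t • z, y t) h + t •
          (fderiv ℝ f (x0 + t • z, y t) (z, f (x0 + t • z, y t) z)) h)) (by
        simp only [id, one_smul]
        abel)
      exact h6
    have hG := dist_le_of_approx_trajectories_ODE_of_mem (a := 0) (b := 1) (δ := 0)
      (εf := 0) (εg := B * ‖h‖ ^ 2) (K := (C * r).toNNReal)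
      (v := fun t w => f (x0 + t • (z + h), w) (z + h)) (s := fun _ => closedBall y0 (2 * δ))
      (f := u) (g := v)
      (f' := fun t => f (x0 + t • (z + h), u t) (z + h))
      (g' := fun t => f (x0 + t • z, y t) z + (f (x0 + t • z, y t) h + t •
          (fderiv ℝ f (x0 + t • z, y t) (z, f (x0 + t • z, y t) z)) h))
      (fun t ht => hglip (z + h) hzh t ⟨ht.1, ht.2.le⟩)
      (fun t ht => (hud t ht).continuousWithinAt)
      (fun t ht => (hud t ⟨ht.1, ht.2.le⟩).mono_of_mem_nhdsWithin (Icc_mem_nhdsGE_of_mem ht))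
      (fun t ht => by simp)
      (fun t ht => by rw [mem_closedBall, dist_eq_norm]; linarith [hub t])
      (fun t ht => (hvd t ht).continuousWithinAt)
      (fun t ht => (hvd t ⟨ht.1, ht.2.le⟩).mono_of_mem_nhdsWithin (Icc_mem_nhdsGE_of_mem ht))
      ?_
      (fun t ht => by rw [mem_closedBall, dist_eq_norm]; exact hvb t ⟨ht.1, ht.2.le⟩)
      (by simp [hv, hu0, hy0]) 1 (by simp)
    · rw [gronwallBound_of_K_ne_0 (by
        rw [Real.coe_toNNReal _ (by positivity)]; positivity),
        Real.coe_toNNReal _ (by positivity)] at hG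
      rw [dist_eq_norm] at hG
      simp only [hv, one_smul] at hG
      rw [← sub_sub] at hG
      refine hG.trans (le_of_eq ?_)
      simp only [zero_mul, zero_add, sub_zero, mul_one]
      ring
    · intro t ht'
      have ht : t ∈ Icc (0:ℝ) 1 := ⟨ht'.1, ht'.2.le⟩
      set p : X × E := (x0 + t • z, y t) with hpdef
      have hpm : p ∈ closedBall (x0, y0) (2 * δ) := hp t ht
      set q : X × E := (h, f p h) with hq
      have hqn : ‖q‖ ≤ (1 + C) * ‖h‖ := by
        rw [hq, Prod.norm_def, max_le_iff]
        have := hfh t ht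
        constructor
        · nlinarith [norm_nonneg h]
        · simp only; nlinarith [norm_nonneg h]
      have hpq : (x0 + t • (z + h), v t) = p + t • q := by
        simp only [hpdef, hq, hv, Prod.smul_mk, Prod.mk_add_mk, smul_add, add_assoc]
      have hpqm : p + t • q ∈ closedBall (x0, y0) (2 * δ) := by
        rw [← hpq]
        exact (hmem _ _).2 ⟨by linarith [hseg (z + h) hzh t ht], hvb t ht⟩
      have htq : ‖t • q‖ ≤ (1 + C) * ‖h‖ := by
        rw [norm_smul, Real.norm_eq_abs, abs_of_nonneg ht.1]
        nlinarith [norm_nonneg q, ht.1, ht.2]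
      have hR : ‖f (p + t • q) - f p - fderiv ℝ f p (t • q)‖ ≤ K * (1 + C) ^ 2 * ‖h‖ ^ 2 := by
        have hsegm : segment ℝ p (p + t • q) ⊆ closedBall (x0, y0) (2 * δ) :=
          hconv.segment_subset hpm hpqm
        have := (convex_segment p (p + t • q)).norm_image_sub_le_of_norm_fderiv_le' (f := f)
          (φ := fderiv ℝ f p) (C := K * ‖t • q‖) (x := p) (y := p + t • q)
          (fun w hw => hd w (hsegm hw)) (fun w hw => by
            have h1 := hK.dist_le_mul w (hsegm hw) p hpm
            rw [dist_eq_norm, dist_eq_norm] at h1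
            refine h1.trans ?_
            gcongr
            have h2 := norm_sub_le_of_mem_segment hw
            rw [add_sub_cancel_left] at h2
            exact h2)
          (left_mem_segment _ _ _) (right_mem_segment _ _ _)
        rw [add_sub_cancel_left] at this
        refine this.trans ?_
        calc K * ‖t • q‖ * ‖t • q‖ ≤ K * ((1 + C) * ‖h‖) * ((1 + C) * ‖h‖) := by gcongr
          _ = _ := by ring
      rw [hpq, hcomp p hpm z h, dist_eq_norm]
      have hid : f p z + (f p h + t • (fderiv ℝ f p (h, f p h)) z) - f (p + t • q) (z + h) =
          - ((f (p + t • q) - f p - fderiv ℝ f p (t • q)) (z + h)) - t • fderiv ℝ f p q h := by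
        simp only [_root_.sub_apply, map_add, map_smul, ← hq,
          _root_.smul_apply]
        abel
      rw [hid]
      calc _ ≤ ‖(f (p + t • q) - f p - fderiv ℝ f p (t • q)) (z + h)‖ + ‖t • fderiv ℝ f p q h‖ := by
            rw [← norm_neg ((f (p + t • q) - f p - fderiv ℝ f p (t • q)) (z + h))]
            exact norm_sub_le _ _
        _ ≤ (K * (1 + C) ^ 2 * ‖h‖ ^ 2) * r + C * ((1 + C) * ‖h‖) * ‖h‖ := by
            gcongr
            · exact (ContinuousLinearMap.le_opNorm _ _).trans (by gcongr)
            · rw [norm_smul, Real.norm_eq_abs, abs_of_nonneg ht.1]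
              calc t * ‖fderiv ℝ f p q h‖ ≤ 1 * ‖fderiv ℝ f p q h‖ := by
                    gcongr; exact ht.2
                _ = ‖fderiv ℝ f p q h‖ := one_mul _
                _ ≤ ‖fderiv ℝ f p q‖ * ‖h‖ := ContinuousLinearMap.le_opNorm _ _
                _ ≤ (‖fderiv ℝ f p‖ * ‖q‖) * ‖h‖ := by
                    gcongr; exact ContinuousLinearMap.le_opNorm _ _
                _ ≤ _ := by gcongr; exact hb' p hpm
        _ = B * ‖h‖ ^ 2 := by rw [hB]; ring
  rw [hasFDerivAt_iff_isLittleO_nhds_zero]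
  refine IsBigO.trans_isLittleO (g := fun h : X => ‖h‖ ^ 2) ?_ (isLittleO_norm_pow_id one_lt_two)
  apply IsBigO.of_bound (B / (C * r) * (Real.exp (C * r) - 1))
  have e1 : ∀ᶠ h : X in 𝓝 0, ‖z + h‖ < r := by
    have : ContinuousAt (fun h : X => ‖z + h‖) 0 := by fun_prop
    exact this.eventually_lt continuousAt_const (by simpa using hx)
  have e2 : ∀ᶠ h : X in 𝓝 0, C * ‖h‖ < δ := by
    have : ContinuousAt (fun h : X => C * ‖h‖) 0 := by fun_prop
    exact this.eventually_lt continuousAt_const (by simpa using hδ)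
  filter_upwards [e1, e2] with h h1 h2
  have := key h h1 h2.le
  rw [add_assoc, add_sub_cancel_left, add_sub_cancel_left, norm_pow, norm_norm]
  exact this

theorem fr_exists [CompleteSpace E] (f : X × E → X →L[ℝ] E) (x0 : X) (y0 : E)
    (hf : ContDiffAt ℝ 2 f (x0, y0))
    (hcomp : ∀ᶠ p in 𝓝 (x0, y0), ∀ h k : X,
      fderiv ℝ f p (h, f p h) k = fderiv ℝ f p (k, f p k) h) :
    ∃ r > 0, ∃ Y : X → E, Y x0 = y0 ∧ ∀ x ∈ ball x0 r, HasFDerivAt Y (f (x, Y x)) x := by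
  have hf1 : ContDiffAt ℝ 1 (fderiv ℝ f) (x0, y0) := hf.fderiv_right (by norm_num)
  obtain ⟨K, s, hs, hK⟩ := hf1.exists_lipschitzOnWith
  have e1 : ∀ᶠ p in 𝓝 (x0, y0), DifferentiableAt ℝ f p :=
    (hf.eventually (by simp)).mono fun p hp => hp.differentiableAt (by norm_num)
  set C := max (‖f (x0, y0)‖ + 1) (‖fderiv ℝ f (x0, y0)‖ + 1)
  have hC : 0 < C := lt_max_of_lt_left (by positivity)
  have e2 : ∀ᶠ p in 𝓝 (x0, y0), ‖f p‖ < C :=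
    hf.continuousAt.norm.eventually_lt continuousAt_const
      (lt_max_of_lt_left (by linarith))
  have e3 : ∀ᶠ p in 𝓝 (x0, y0), ‖fderiv ℝ f p‖ < C := by
    have hc := hf1.continuousAt.eventually_mem
      (ball_mem_nhds (fderiv ℝ f (x0, y0)) one_pos)
    filter_upwards [hc] with p hp
    have hp : ‖fderiv ℝ f p - fderiv ℝ f (x0, y0)‖ < 1 :=
      lt_of_eq_of_lt (dist_eq_norm (fderiv ℝ f p) (fderiv ℝ f (x0, y0))).symm hp
    have h1 := norm_le_norm_add_norm_sub' (fderiv ℝ f p) (fderiv ℝ f (x0, y0))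
    have h2 : ‖fderiv ℝ f (x0, y0)‖ + 1 ≤ C := le_max_right _ _
    linarith
  have := e1.and (e2.and (e3.and (hcomp.and hs)))
  obtain ⟨ε, hε, hsub⟩ := Metric.nhds_basis_closedBall.eventually_iff.1 this
  have h2 : 2 * (ε / 2) = ε := by ring
  refine fr_core f x0 y0 (ε / 2) C K (by positivity) hC ?_ ?_ ?_ ?_ ?_
  all_goals rw [h2]
  · exact fun p hp => (hsub hp).1
  · exact fun p hp => (hsub hp).2.1.le
  · exact fun p hp => (hsub hp).2.2.1.le
  · exact hK.mono fun p hp => (hsub hp).2.2.2.2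
  · exact fun p hp => (hsub hp).2.2.2.1

theorem fr_unique (f : X × E → X →L[ℝ] E) (W : Set X) (hW : IsOpen W) (hc : IsPreconnected W)
    (Y Z : X → E)
    (hf : ∀ x ∈ W, ContDiffAt ℝ 1 f (x, Y x))
    (hY : ∀ x ∈ W, HasFDerivAt Y (f (x, Y x)) x) (hZ : ∀ x ∈ W, HasFDerivAt Z (f (x, Z x)) x)
    (x0 : X) (hx0 : x0 ∈ W) (h0 : Y x0 = Z x0) : ∀ x ∈ W, Y x = Z x := by
  have hloc : ∀ x ∈ W, Y x = Z x → ∀ᶠ w in 𝓝 x, Y w = Z w := by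
    intro x hx hxx
    obtain ⟨K, s, hs, hK⟩ := (hf x hx).exists_lipschitzOnWith
    have c1 : ContinuousAt (fun w => (w, Y w)) x := continuousAt_id.prodMk (hY x hx).continuousAt
    have c2 : ContinuousAt (fun w => (w, Z w)) x := continuousAt_id.prodMk (hZ x hx).continuousAt
    have e1 := c1.eventually_mem hs
    have e2 := c2.eventually_mem (s := s) (by simpa only [← hxx] using hs)
    obtain ⟨ε, hε, hsub⟩ := Metric.nhds_basis_ball.eventually_iff.1
      (e1.and (e2.and (hW.eventually_mem hx)))
    filter_upwards [ball_mem_nhds x hε] with w hw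
    obtain ⟨h, rfl⟩ : ∃ h, w = x + h := ⟨w - x, by abel⟩
    rw [mem_ball, dist_eq_norm, add_sub_cancel_left] at hw
    have hm : ∀ t ∈ Icc (0:ℝ) 1, x + t • h ∈ ball x ε := by
      intro t ht
      rw [mem_ball, dist_eq_norm, add_sub_cancel_left, norm_smul, Real.norm_eq_abs,
        abs_of_nonneg ht.1]
      nlinarith [ht.1, ht.2, norm_nonneg h]
    have hD : ∀ T : X → E, (∀ x ∈ W, HasFDerivAt T (f (x, T x)) x) → ∀ t ∈ Icc (0:ℝ) 1,
        HasDerivAt (fun s : ℝ => T (x + s • h)) (f (x + t • h, T (x + t • h)) h) t := by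
      intro T hT t ht
      have h1 : HasDerivAt (fun s : ℝ => x + s • h) h t := by
        simpa using ((hasDerivAt_id t).smul_const h).const_add x
      exact (hT _ (hsub (hm t ht)).2.2).comp_hasDerivAt t h1
    have := ODE_solution_unique_of_mem_Icc_right (a := 0) (b := 1)
      (v := fun t w => f (x + t • h, w) h) (s := fun t => {w | (x + t • h, w) ∈ s})
      (K := K * ‖h‖₊) (f := fun t => Y (x + t • h)) (g := fun t => Z (x + t • h))
      (fun t ht => by
        apply LipschitzOnWith.of_dist_le_mul
        intro a ha b hb
        have h1 := hK.dist_le_mul _ ha _ hb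
        rw [dist_eq_norm, ← _root_.sub_apply]
        refine (ContinuousLinearMap.le_opNorm _ _).trans ?_
        rw [dist_eq_norm] at h1
        have h2 : dist (x + t • h, a) (x + t • h, b) = dist a b := by
          simp [Prod.dist_eq]
        rw [h2] at h1
        push_cast
        calc _ ≤ (K * dist a b) * ‖h‖ := by gcongr
          _ = _ := by ring)
      (fun t ht => (hD Y hY t ht).continuousAt.continuousWithinAt)
      (fun t ht => (hD Y hY t ⟨ht.1, ht.2.le⟩).hasDerivWithinAt)
      (fun t ht => (hsub (hm t ⟨ht.1, ht.2.le⟩)).1)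
      (fun t ht => (hD Z hZ t ht).continuousAt.continuousWithinAt)
      (fun t ht => (hD Z hZ t ⟨ht.1, ht.2.le⟩).hasDerivWithinAt)
      (fun t ht => (hsub (hm t ⟨ht.1, ht.2.le⟩)).2.1)
      (by simpa using hxx)
    simpa using this (right_mem_Icc.2 zero_le_one)
  set S : Set X := {x | ∀ᶠ w in 𝓝 x, Y w = Z w} with hS
  have hSo : IsOpen S := isOpen_setOfPred_eventually_nhds
  have := hc.subset_of_closure_inter_subset hSo ⟨x0, hx0, hloc x0 hx0 h0⟩ ?_
  · exact fun x hx => (this hx).self_of_nhds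
  · rintro x ⟨hxc, hxW⟩
    apply hloc x hxW
    have hfr : ∃ᶠ w in 𝓝 x, Y w = Z w :=
      (mem_closure_iff_frequently.1 hxc).mono fun w hw => hw.self_of_nhds
    by_contra hne
    exact hfr (((hY x hxW).continuousAt.ne_iff_eventually_ne (hZ x hxW).continuousAt).1 hne)

theorem fr_smooth (f : X × E → X →L[ℝ] E) (W : Set X) (hW : IsOpen W) (Y : X → E)
    (hf : ContDiffOn ℝ (⊤ : ℕ∞) f (W ×ˢ univ))
    (hY : ∀ x ∈ W, HasFDerivAt Y (f (x, Y x)) x) : ContDiffOn ℝ (⊤ : ℕ∞) Y W := by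
  rw [contDiffOn_infty]
  intro k
  induction k with
  | zero => exact contDiffOn_zero.2 fun x hx => (hY x hx).continuousAt.continuousWithinAt
  | succ k ih =>
    push_cast
    rw [contDiffOn_succ_iff_fderiv_of_isOpen hW]
    refine ⟨fun x hx => (hY x hx).differentiableAt.differentiableWithinAt, by simp, ?_⟩
    have : ContDiffOn ℝ k (fun x => f (x, Y x)) W :=
      (hf.of_le (by exact_mod_cast le_top)).comp (contDiffOn_id.prodMk ih) fun x hx => ⟨hx, trivial⟩
    exact this.congr fun x hx => (hY x hx).fderiv
end frob


section ric
open Set Metric Topology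
variable {n : ℕ} {R : Type*} [NormedRing R] [NormedAlgebra ℝ R]

noncomputable def ricG (A B W : (Fin n → ℝ) → R) (p : (Fin n → ℝ) × R) : R :=
  p.2 * A p.1 * p.2 - B p.1 - p.2 * W p.1

noncomputable def ricF (A B W : Fin n → (Fin n → ℝ) → R) (p : (Fin n → ℝ) × R) :
    (Fin n → ℝ) →L[ℝ] R :=
  ∑ m, (ContinuousLinearMap.proj m : (Fin n → ℝ) →L[ℝ] ℝ).smulRight (ricG (A m) (B m) (W m) p)

theorem ricF_apply (A B W : Fin n → (Fin n → ℝ) → R) (p : (Fin n → ℝ) × R) (h : Fin n → ℝ) :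
    ricF A B W p h = ∑ m, h m • ricG (A m) (B m) (W m) p := by
  simp [ricF]

theorem ricF_single (A B W : Fin n → (Fin n → ℝ) → R) (p : (Fin n → ℝ) × R) (m : Fin n) :
    ricF A B W p (Pi.single m 1) = ricG (A m) (B m) (W m) p := by
  rw [ricF_apply, Finset.sum_eq_single m]
  · simp
  · intro b _ hb; simp [Pi.single_apply, hb]
  · simp

theorem ricG_contDiffAt (A B W : (Fin n → ℝ) → R) (p : (Fin n → ℝ) × R) (k : WithTop ℕ∞)
    (hA : ContDiffAt ℝ k A p.1) (hB : ContDiffAt ℝ k B p.1)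
    (hW : ContDiffAt ℝ k W p.1) : ContDiffAt ℝ k (ricG A B W) p := by
  have h1 : ContDiffAt ℝ k (fun p : (Fin n → ℝ) × R => A p.1) p := hA.comp p contDiffAt_fst
  have h2 : ContDiffAt ℝ k (fun p : (Fin n → ℝ) × R => B p.1) p := hB.comp p contDiffAt_fst
  have h3 : ContDiffAt ℝ k (fun p : (Fin n → ℝ) × R => W p.1) p := hW.comp p contDiffAt_fst
  have h4 : ContDiffAt ℝ k (fun p : (Fin n → ℝ) × R => p.2) p := contDiffAt_snd
  exact (((h4.mul h1).mul h4).sub h2).sub (h4.mul h3)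

theorem ricF_contDiffAt (A B W : Fin n → (Fin n → ℝ) → R) (p : (Fin n → ℝ) × R) (k : WithTop ℕ∞)
    (hA : ∀ m, ContDiffAt ℝ k (A m) p.1) (hB : ∀ m, ContDiffAt ℝ k (B m) p.1)
    (hW : ∀ m, ContDiffAt ℝ k (W m) p.1) : ContDiffAt ℝ k (ricF A B W) p := by
  unfold ricF
  exact ContDiffAt.sum fun m _ => contDiffAt_const.smulRight
    (ricG_contDiffAt _ _ _ p k (hA m) (hB m) (hW m))

theorem ricG_fderiv (A B W : (Fin n → ℝ) → R) (p : (Fin n → ℝ) × R)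
    (hA : DifferentiableAt ℝ A p.1) (hB : DifferentiableAt ℝ B p.1)
    (hW : DifferentiableAt ℝ W p.1) (h : Fin n → ℝ) (k : R) :
    fderiv ℝ (ricG A B W) p (h, k) = k * A p.1 * p.2 + p.2 * fderiv ℝ A p.1 h * p.2
      + p.2 * A p.1 * k - fderiv ℝ B p.1 h - (k * W p.1 + p.2 * fderiv ℝ W p.1 h) := by
  have h1 : HasFDerivAt (fun p : (Fin n → ℝ) × R => A p.1) _ p :=
    hA.hasFDerivAt.comp p hasFDerivAt_fst
  have h2 : HasFDerivAt (fun p : (Fin n → ℝ) × R => B p.1) _ p :=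
    hB.hasFDerivAt.comp p hasFDerivAt_fst
  have h3 : HasFDerivAt (fun p : (Fin n → ℝ) × R => W p.1) _ p :=
    hW.hasFDerivAt.comp p hasFDerivAt_fst
  have h4 : HasFDerivAt (fun p : (Fin n → ℝ) × R => p.2)
      (ContinuousLinearMap.snd ℝ (Fin n → ℝ) R) p := hasFDerivAt_snd
  have h5 : HasFDerivAt (ricG A B W) _ p :=
    (((h4.mul' h1).mul' h4).sub h2).sub (h4.mul' h3)
  rw [h5.fderiv]
  simp
  noncomm_ring

theorem ricF_comp (A B W : Fin n → (Fin n → ℝ) → R) (p : (Fin n → ℝ) × R)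
    (hA : ∀ m, DifferentiableAt ℝ (A m) p.1) (hB : ∀ m, DifferentiableAt ℝ (B m) p.1)
    (hW : ∀ m, DifferentiableAt ℝ (W m) p.1)
    (rA : ∀ l m, fderiv ℝ (A m) p.1 (Pi.single l 1) - fderiv ℝ (A l) p.1 (Pi.single m 1) =
      W l p.1 * A m p.1 - W m p.1 * A l p.1)
    (rB : ∀ l m, fderiv ℝ (B m) p.1 (Pi.single l 1) - fderiv ℝ (B l) p.1 (Pi.single m 1) =
      B l p.1 * W m p.1 - B m p.1 * W l p.1)
    (rW : ∀ l m, fderiv ℝ (W m) p.1 (Pi.single l 1) - fderiv ℝ (W l) p.1 (Pi.single m 1) =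
      W l p.1 * W m p.1 - W m p.1 * W l p.1 + A l p.1 * B m p.1 - A m p.1 * B l p.1)
    (rBA : ∀ l m, B l p.1 * A m p.1 = B m p.1 * A l p.1) (h k : Fin n → ℝ) :
    fderiv ℝ (ricF A B W) p (h, ricF A B W p h) k =
      fderiv ℝ (ricF A B W) p (k, ricF A B W p k) h := by
  have hG : ∀ m, HasFDerivAt (ricG (A m) (B m) (W m)) (fderiv ℝ (ricG (A m) (B m) (W m)) p) p :=
    fun m => by
      have h1 : DifferentiableAt ℝ (fun p : (Fin n → ℝ) × R => A m p.1) p :=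
        (hA m).comp p differentiableAt_fst
      have h2 : DifferentiableAt ℝ (fun p : (Fin n → ℝ) × R => B m p.1) p :=
        (hB m).comp p differentiableAt_fst
      have h3 : DifferentiableAt ℝ (fun p : (Fin n → ℝ) × R => W m p.1) p :=
        (hW m).comp p differentiableAt_fst
      have h4 : DifferentiableAt ℝ (fun p : (Fin n → ℝ) × R => p.2) p := differentiableAt_snd
      exact DifferentiableAt.hasFDerivAt
        ((((h4.mul h1).mul h4).sub h2).sub (h4.mul h3))
  have hF : ∀ v : (Fin n → ℝ) × R, ∀ k : Fin n → ℝ, fderiv ℝ (ricF A B W) p v k =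
      ∑ m, k m • fderiv ℝ (ricG (A m) (B m) (W m)) p v := by
    intro v k
    have hdF : DifferentiableAt ℝ (ricF A B W) p := by
      unfold ricF
      refine DifferentiableAt.fun_sum fun m _ => ?_
      exact ((ContinuousLinearMap.smulRightL ℝ (Fin n → ℝ) R
        (ContinuousLinearMap.proj m)).differentiableAt).comp p (hG m).differentiableAt
    have e1 : HasFDerivAt (fun q => ricF A B W q k)
        ((ContinuousLinearMap.apply ℝ R k).comp (fderiv ℝ (ricF A B W) p)) p :=
      (ContinuousLinearMap.apply ℝ R k).hasFDerivAt.comp p hdF.hasFDerivAt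
    have e2 : HasFDerivAt (fun q => ricF A B W q k)
        (∑ m, k m • fderiv ℝ (ricG (A m) (B m) (W m)) p) p := by
      simp only [ricF_apply]
      exact HasFDerivAt.fun_sum fun m _ => (hG m).const_smul (k m)
    have := congrArg (fun T => T v) (e1.unique e2)
    simpa [_root_.sum_apply] using this
  have hQ : ∀ m (h : Fin n → ℝ), fderiv ℝ (ricG (A m) (B m) (W m)) p (h, ricF A B W p h) =
      ∑ l, h l • fderiv ℝ (ricG (A m) (B m) (W m)) p
        (Pi.single l 1, ricG (A l) (B l) (W l) p) := by
    intro m h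
    have := LinearMap.pi_apply_eq_sum_univ (((fderiv ℝ (ricG (A m) (B m) (W m)) p).comp
      ((ContinuousLinearMap.id ℝ (Fin n → ℝ)).prod (ricF A B W p))) : (Fin n → ℝ) →ₗ[ℝ] R) h
    have e : ∀ l : Fin n, (fun j => if l = j then (1:ℝ) else 0) = Pi.single l 1 := by
      intro l; ext j; simp [Pi.single_apply, eq_comm]
    simp only [e] at this
    simpa [ricF_single] using this
  have hS : ∀ l m, fderiv ℝ (ricG (A m) (B m) (W m)) p (Pi.single l 1, ricG (A l) (B l) (W l) p)
      = fderiv ℝ (ricG (A l) (B l) (W l)) p (Pi.single m 1, ricG (A m) (B m) (W m) p) := by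
    intro l m
    rw [ricG_fderiv _ _ _ _ (hA m) (hB m) (hW m), ricG_fderiv _ _ _ _ (hA l) (hB l) (hW l)]
    rw [sub_eq_iff_eq_add.1 (rA l m), sub_eq_iff_eq_add.1 (rB l m), sub_eq_iff_eq_add.1 (rW l m)]
    have e1 : B l p.1 * A m p.1 * p.2 = B m p.1 * A l p.1 * p.2 := by rw [rBA l m]
    unfold ricG
    rw [← sub_eq_zero] at e1 ⊢
    rw [← neg_eq_zero, ← e1]
    noncomm_ring
  rw [hF, hF]
  simp only [hQ, Finset.smul_sum]
  rw [Finset.sum_comm]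
  refine Finset.sum_congr rfl fun l _ => Finset.sum_congr rfl fun m _ => ?_
  rw [hS l m, smul_comm]
end ric


section absr
open Set Metric Topology
variable {n : ℕ}

theorem clm_ext_single {R : Type*} [NormedAddCommGroup R] [NormedSpace ℝ R]
    {D D' : (Fin n → ℝ) →L[ℝ] R}
    (h : ∀ m, D (Pi.single m 1) = D' (Pi.single m 1)) : D = D' := by
  ext v
  have e : ∀ l : Fin n, (fun j => if l = j then (1:ℝ) else 0) = Pi.single l 1 := by
    intro l; ext j; simp [Pi.single_apply, eq_comm]
  have h1 := LinearMap.pi_apply_eq_sum_univ (D : (Fin n → ℝ) →ₗ[ℝ] R) v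
  have h2 := LinearMap.pi_apply_eq_sum_univ (D' : (Fin n → ℝ) →ₗ[ℝ] R) v
  simp only [e, ContinuousLinearMap.coe_coe, h] at h1 h2
  rw [h1, h2]


variable {R : Type*} [NormedRing R] [NormedAlgebra ℝ R]

theorem abs_fderiv_one (T : R →L[ℝ] R) (V : Set (Fin n → ℝ)) (hV : IsOpen V)
    (L : (Fin n → ℝ) → R) (x : Fin n → ℝ) (hx : x ∈ V) (D : (Fin n → ℝ) →L[ℝ] R)
    (hLd : HasFDerivAt L D x) (h2 : ∀ x ∈ V, L x * T (L x) = 1) (v : Fin n → ℝ) :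
    D v * T (L x) + L x * T (D v) = 0 := by
  have hLt : HasFDerivAt (fun y => T (L y)) (T.comp D) x := T.hasFDerivAt.comp x hLd
  have hc : HasFDerivAt (fun y => L y * T (L y)) (0 : (Fin n → ℝ) →L[ℝ] R) x := by
    refine (hasFDerivAt_const (1 : R) x).congr_of_eventuallyEq ?_
    filter_upwards [hV.mem_nhds hx] with y hy using h2 y hy
  have hu := (hLd.mul' hLt).unique hc
  have := congrArg (fun S => S v) hu
  simp at this
  rw [add_comm]; exact this

theorem orth_pres (T : R →L[ℝ] R) (hT : ∀ x y, T (x * y) = T y * T x)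
    (hTT : ∀ x, T (T x) = x)
    (A B W : Fin n → (Fin n → ℝ) → R) (V : Set (Fin n → ℝ)) (hV : IsOpen V)
    (hVc : IsPreconnected V)
    (hAB : ∀ x ∈ V, ∀ m, T (A m x) = B m x)
    (hWW : ∀ x ∈ V, ∀ m, T (W m x) = - W m x)
    (hA : ∀ x ∈ V, ∀ m, ContDiffAt ℝ 1 (A m) x)
    (hB : ∀ x ∈ V, ∀ m, ContDiffAt ℝ 1 (B m) x)
    (L : (Fin n → ℝ) → R)
    (hs : ∀ x ∈ V, ContDiffAt ℝ 1 L x)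
    (hL : ∀ x ∈ V, HasFDerivAt L (ricF A B W (x, L x)) x)
    (x0 : Fin n → ℝ) (hx0 : x0 ∈ V) (h0 : L x0 * T (L x0) = 1) :
    ∀ x ∈ V, L x * T (L x) = 1 := by
  let Q : Fin n → (Fin n → ℝ) × R → R :=
    fun m p => L p.1 * A m p.1 * (p.2 - 1) + (p.2 - 1) * B m p.1 * T (L p.1)
  let f : (Fin n → ℝ) × R → (Fin n → ℝ) →L[ℝ] R :=
    fun p => ∑ m, (ContinuousLinearMap.proj m : (Fin n → ℝ) →L[ℝ] ℝ).smulRight (Q m p)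
  have hfs : ∀ p m, f p (Pi.single m 1) = Q m p := by
    intro p m
    have : f p (Pi.single m 1) = ∑ l, (Pi.single m 1 : Fin n → ℝ) l • Q l p := by
      simp [f]
    rw [this, Finset.sum_eq_single m]
    · simp
    · intro l _ hl; simp [hl]
    · simp
  refine fr_unique f V hV hVc (fun x => L x * T (L x)) (fun _ => 1) ?_ ?_ ?_ x0 hx0 h0
  · intro x hx
    refine ContDiffAt.sum fun m _ => contDiffAt_const.smulRight ?_
    have e1 : ContDiffAt ℝ 1 (fun p : (Fin n → ℝ) × R => L p.1)
      (x, L x * T (L x)) := ContDiffAt.comp (x, L x * T (L x)) (hs x hx) contDiffAt_fst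
    have e2 : ContDiffAt ℝ 1 (fun p : (Fin n → ℝ) × R => A m p.1)
      (x, L x * T (L x)) := ContDiffAt.comp (x, L x * T (L x)) (hA x hx m) contDiffAt_fst
    have e3 : ContDiffAt ℝ 1 (fun p : (Fin n → ℝ) × R => B m p.1)
      (x, L x * T (L x)) := ContDiffAt.comp (x, L x * T (L x)) (hB x hx m) contDiffAt_fst
    have e4 : ContDiffAt ℝ 1 (fun p : (Fin n → ℝ) × R => p.2 - 1)
      (x, L x * T (L x)) := contDiffAt_snd.sub contDiffAt_const
    have e5 : ContDiffAt ℝ 1 (fun p : (Fin n → ℝ) × R => T (L p.1))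
      (x, L x * T (L x)) := T.contDiff.contDiffAt.comp _ e1
    exact ((e1.mul e2).mul e4).add ((e4.mul e3).mul e5)
  · intro x hx
    have hLd := hL x hx
    have hLt : HasFDerivAt (fun y => T (L y)) (T.comp (ricF A B W (x, L x))) x :=
      T.hasFDerivAt.comp x hLd
    have hG := hLd.mul' hLt
    refine hG.congr_fderiv ?_
    apply clm_ext_single
    intro m
    rw [hfs]
    have hBA : T (B m x) = A m x := by rw [← hAB x hx, hTT]
    simp [ricF_single, Q, ricG, hT, hAB x hx, hBA, hWW x hx m]
    noncomm_ring
  · intro x hx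
    refine (hasFDerivAt_const (1 : R) x).congr_fderiv ?_
    apply clm_ext_single
    intro m
    rw [hfs]
    simp [Q]

theorem abs_exists [CompleteSpace R] (T : R →L[ℝ] R) (hT : ∀ x y, T (x * y) = T y * T x)
    (hTT : ∀ x, T (T x) = x)
    (A B W : Fin n → (Fin n → ℝ) → R) (U : Set (Fin n → ℝ)) (hU : IsOpen U)
    (hAB : ∀ x ∈ U, ∀ m, T (A m x) = B m x)
    (hWW : ∀ x ∈ U, ∀ m, T (W m x) = - W m x)
    (hAs : ∀ x ∈ U, ∀ m, ContDiffAt ℝ (⊤ : ℕ∞) (A m) x)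
    (hBs : ∀ x ∈ U, ∀ m, ContDiffAt ℝ (⊤ : ℕ∞) (B m) x)
    (hWs : ∀ x ∈ U, ∀ m, ContDiffAt ℝ (⊤ : ℕ∞) (W m) x)
    (rA : ∀ x ∈ U, ∀ l m, fderiv ℝ (A m) x (Pi.single l 1) - fderiv ℝ (A l) x (Pi.single m 1) =
      W l x * A m x - W m x * A l x)
    (rB : ∀ x ∈ U, ∀ l m, fderiv ℝ (B m) x (Pi.single l 1) - fderiv ℝ (B l) x (Pi.single m 1) =
      B l x * W m x - B m x * W l x)
    (rW : ∀ x ∈ U, ∀ l m, fderiv ℝ (W m) x (Pi.single l 1) - fderiv ℝ (W l) x (Pi.single m 1) =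
      W l x * W m x - W m x * W l x + A l x * B m x - A m x * B l x)
    (rBA : ∀ x ∈ U, ∀ l m, B l x * A m x = B m x * A l x)
    (x₀ : Fin n → ℝ) (hx₀ : x₀ ∈ U) (L₀ : R) (hL₀ : L₀ * T L₀ = 1) :
    ∃ V : Set (Fin n → ℝ), IsOpen V ∧ x₀ ∈ V ∧ V ⊆ U ∧ ∃ L : (Fin n → ℝ) → R,
      L x₀ = L₀ ∧ ContDiffOn ℝ (⊤ : ℕ∞) L V ∧ (∀ x ∈ V, L x * T (L x) = 1) ∧
      ∀ x ∈ V, HasFDerivAt L (ricF A B W (x, L x)) x := by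
  have hFs : ∀ x ∈ U, ∀ y, ContDiffAt ℝ (⊤ : ℕ∞) (ricF A B W) (x, y) :=
    fun x hx y => ricF_contDiffAt _ _ _ _ _ (hAs x hx) (hBs x hx) (hWs x hx)
  have le1 : ((1 : ℕ∞) : WithTop ℕ∞) ≤ ((⊤ : ℕ∞) : WithTop ℕ∞) := by exact_mod_cast le_top
  have le2 : ((2 : ℕ∞) : WithTop ℕ∞) ≤ ((⊤ : ℕ∞) : WithTop ℕ∞) := by exact_mod_cast le_top
  obtain ⟨r, hr, L, hL0, hL⟩ := fr_exists (ricF A B W) x₀ L₀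
    ((hFs x₀ hx₀ L₀).of_le le2) (by
      have : ∀ᶠ p : (Fin n → ℝ) × R in 𝓝 (x₀, L₀), p.1 ∈ U :=
        continuousAt_fst.eventually_mem (hU.mem_nhds hx₀)
      filter_upwards [this] with p hp
      exact ricF_comp A B W p (fun m => (hAs _ hp m).differentiableAt (by simp))
        (fun m => (hBs _ hp m).differentiableAt (by simp))
        (fun m => (hWs _ hp m).differentiableAt (by simp))
        (rA _ hp) (rB _ hp) (rW _ hp) (rBA _ hp))
  obtain ⟨s, hs, hsU⟩ := Metric.isOpen_iff.1 hU x₀ hx₀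
  have hsub1 : ball x₀ (min r s) ⊆ ball x₀ r := ball_subset_ball (min_le_left _ _)
  have hsub2 : ball x₀ (min r s) ⊆ U := (ball_subset_ball (min_le_right _ _)).trans hsU
  have hmem : x₀ ∈ ball x₀ (min r s) := mem_ball_self (lt_min hr hs)
  have hLs : ContDiffOn ℝ (⊤ : ℕ∞) L (ball x₀ (min r s)) :=
    fr_smooth (ricF A B W) _ isOpen_ball L
      (fun p hp => (hFs p.1 (hsub2 hp.1) p.2).contDiffWithinAt) (fun x hx => hL x (hsub1 hx))
  refine ⟨ball x₀ (min r s), isOpen_ball, hmem, hsub2, L, hL0, hLs, ?_,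
    fun x hx => hL x (hsub1 hx)⟩
  exact orth_pres T hT hTT A B W _ isOpen_ball (convex_ball _ _).isPreconnected
    (fun x hx => hAB x (hsub2 hx)) (fun x hx => hWW x (hsub2 hx))
    (fun x hx m => (hAs x (hsub2 hx) m).of_le le1)
    (fun x hx m => (hBs x (hsub2 hx) m).of_le le1) L
    (fun x hx => (hLs.contDiffAt (isOpen_ball.mem_nhds hx)).of_le le1)
    (fun x hx => hL x (hsub1 hx)) x₀ hmem (by rw [hL0, hL₀])

theorem abs_unique (A B W : Fin n → (Fin n → ℝ) → R) (V : Set (Fin n → ℝ)) (hV : IsOpen V)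
    (hVc : IsPreconnected V)
    (hAs : ∀ x ∈ V, ∀ m, ContDiffAt ℝ (⊤ : ℕ∞) (A m) x)
    (hBs : ∀ x ∈ V, ∀ m, ContDiffAt ℝ (⊤ : ℕ∞) (B m) x)
    (hWs : ∀ x ∈ V, ∀ m, ContDiffAt ℝ (⊤ : ℕ∞) (W m) x)
    (L L' : (Fin n → ℝ) → R)
    (hL : ∀ x ∈ V, HasFDerivAt L (ricF A B W (x, L x)) x)
    (hL' : ∀ x ∈ V, HasFDerivAt L' (ricF A B W (x, L' x)) x)
    (x₀ : Fin n → ℝ) (hx₀ : x₀ ∈ V) (h0 : L x₀ = L' x₀) : ∀ x ∈ V, L x = L' x := by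
  have le1 : ((1 : ℕ∞) : WithTop ℕ∞) ≤ ((⊤ : ℕ∞) : WithTop ℕ∞) := by exact_mod_cast le_top
  exact fr_unique (ricF A B W) V hV hVc L L'
    (fun x hx => (ricF_contDiffAt A B W (x, L x) _ (hAs x hx) (hBs x hx) (hWs x hx)).of_le le1)
    hL hL' x₀ hx₀ h0
end absr

section algp
variable {n : ℕ}
variable [NeZero n]

def mA (a : (Fin n → ℝ) → Fin n → Fin n → ℝ) (m : Fin n) (x : Fin n → ℝ) :
    Matrix (Fin n) (Fin n) ℝ := Matrix.vecMulVec (fun i => a x i m) (Pi.single 0 1)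
def mB (a : (Fin n → ℝ) → Fin n → Fin n → ℝ) (m : Fin n) (x : Fin n → ℝ) :
    Matrix (Fin n) (Fin n) ℝ := Matrix.vecMulVec (Pi.single 0 1) (fun i => a x i m)
def mW (b : (Fin n → ℝ) → Fin n → Fin n → Fin n → ℝ) (m : Fin n) (x : Fin n → ℝ) :
    Matrix (Fin n) (Fin n) ℝ := Matrix.of (fun i k => b x i k m)

theorem mA_t (a : (Fin n → ℝ) → Fin n → Fin n → ℝ) (m : Fin n) (x : Fin n → ℝ) :
    (mA a m x)ᵀ = mB a m x := by
  ext i k; simp [mA, mB, Matrix.vecMulVec_apply, mul_comm]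

theorem mB_t (a : (Fin n → ℝ) → Fin n → Fin n → ℝ) (m : Fin n) (x : Fin n → ℝ) :
    (mB a m x)ᵀ = mA a m x := by
  rw [← mA_t, Matrix.transpose_transpose]

theorem LA_entry (a : (Fin n → ℝ) → Fin n → Fin n → ℝ) (m : Fin n) (x : Fin n → ℝ)
    (L : Matrix (Fin n) (Fin n) ℝ) (i k : Fin n) :
    (L * mA a m x) i k = (∑ j, L i j * a x j m) * (Pi.single 0 1 : Fin n → ℝ) k := by
  simp only [Matrix.mul_apply, mA, Matrix.vecMulVec_apply, Finset.sum_mul, mul_assoc]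

theorem BL_entry (a : (Fin n → ℝ) → Fin n → Fin n → ℝ) (m : Fin n) (x : Fin n → ℝ)
    (L : Matrix (Fin n) (Fin n) ℝ) (i k : Fin n) :
    (mB a m x * Lᵀ) i k = (Pi.single 0 1 : Fin n → ℝ) i * (∑ j, L k j * a x j m) := by
  simp only [Matrix.mul_apply, mB, Matrix.vecMulVec_apply, Finset.mul_sum, mul_assoc,
    Matrix.transpose_apply, mul_comm (a x _ _)]

theorem LWL_entry (b : (Fin n → ℝ) → Fin n → Fin n → Fin n → ℝ) (m : Fin n) (x : Fin n → ℝ)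
    (L : Matrix (Fin n) (Fin n) ℝ) (i j : Fin n) :
    (∑ k, ∑ l, L i k * b x k l m * L j l) = (L * mW b m x * Lᵀ) i j := by
  simp only [Matrix.mul_apply, mW, Matrix.of_apply, Matrix.transpose_apply, Finset.sum_mul]
  exact Finset.sum_comm

theorem alg_from (a : (Fin n → ℝ) → Fin n → Fin n → ℝ)
    (b : (Fin n → ℝ) → Fin n → Fin n → Fin n → ℝ) (m : Fin n) (x : Fin n → ℝ)
    (L P : Matrix (Fin n) (Fin n) ℝ) (hL : L * Lᵀ = 1)
    (hP : P = L * mA a m x * L - mB a m x - L * mW b m x) :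
    P * Lᵀ + L * mW b m x * Lᵀ = L * mA a m x - mB a m x * Lᵀ := by
  rw [hP, sub_mul, sub_mul, mul_assoc _ L Lᵀ, hL]
  noncomm_ring

theorem alg_to (a : (Fin n → ℝ) → Fin n → Fin n → ℝ)
    (b : (Fin n → ℝ) → Fin n → Fin n → Fin n → ℝ) (m : Fin n) (x : Fin n → ℝ)
    (L P : Matrix (Fin n) (Fin n) ℝ) (hL : L * Lᵀ = 1)
    (hW : (mW b m x)ᵀ = - mW b m x) (hs : P * Lᵀ + L * Pᵀ = 0)
    (h1 : ∀ i, i ≠ 0 → (P * Lᵀ) 0 i + (L * mW b m x * Lᵀ) 0 i + (∑ k, L i k * a x k m) = 0)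
    (h2 : ∀ i j, i ≠ j → i ≠ 0 → j ≠ 0 → (P * Lᵀ) i j + (L * mW b m x * Lᵀ) i j = 0) :
    P = L * mA a m x * L - mB a m x - L * mW b m x := by
  have hL' : Lᵀ * L = 1 := mul_eq_one_comm.1 hL
  set N := P * Lᵀ + L * mW b m x * Lᵀ with hN
  have hNs : Nᵀ = - N := by
    rw [hN]
    simp only [Matrix.transpose_add, Matrix.transpose_mul, Matrix.transpose_transpose, hW]
    rw [eq_neg_of_add_eq_zero_right hs]
    noncomm_ring
  have hNe : ∀ i j, N j i = - N i j := fun i j => congrFun (congrFun hNs i) j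
  have hNN : N = L * mA a m x - mB a m x * Lᵀ := by
    ext i j
    rw [Matrix.sub_apply, LA_entry, BL_entry]
    have hd : N i i = 0 := by linarith [hNe i i]
    have hdj : N j j = 0 := by linarith [hNe j j]
    by_cases hij : i = j
    · subst hij
      rw [hd]; ring
    · by_cases hi : i = 0
      · subst hi
        have := h1 j (Ne.symm hij)
        rw [← Matrix.add_apply, ← hN] at this
        simp [Ne.symm hij]
        linarith
      · by_cases hj : j = 0
        · subst hj
          have := h1 i hi
          rw [← Matrix.add_apply, ← hN] at this
          rw [hNe 0 i]
          simp [hi]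
          linarith
        · have := h2 i j hij hi hj
          rw [← Matrix.add_apply, ← hN] at this
          rw [this]; simp [hi, hj]
  have : P = N * L - L * mW b m x := by
    rw [hN, add_mul, mul_assoc P, mul_assoc (L * mW b m x), hL', mul_one, mul_one]
    noncomm_ring
  rw [this, hNN, sub_mul, mul_assoc (mB a m x), hL', mul_one]

theorem W_skew (b : (Fin n → ℝ) → Fin n → Fin n → Fin n → ℝ) (x : Fin n → ℝ)
    (h : ∀ i j m, b x i j m = -b x j i m) (m : Fin n) : (mW b m x)ᵀ = - mW b m x := by
  ext i j; simp [mW, h j i m]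

theorem alg_to2 (a : (Fin n → ℝ) → Fin n → Fin n → ℝ)
    (b : (Fin n → ℝ) → Fin n → Fin n → Fin n → ℝ) (m : Fin n) (x : Fin n → ℝ)
    (L P : Matrix (Fin n) (Fin n) ℝ) (q : Fin n → Fin n → ℝ) (hq : ∀ i k, q i k = P i k)
    (hL : L * Lᵀ = 1)
    (hW : (mW b m x)ᵀ = - mW b m x) (hs : P * Lᵀ + L * Pᵀ = 0)
    (h1 : ∀ i, i ≠ 0 → (∑ k, q 0 k * L i k) + (∑ k, ∑ l, L 0 k * b x k l m * L i l)
      + (∑ k, L i k * a x k m) = 0)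
    (h2 : ∀ i j, i ≠ j → i ≠ 0 → j ≠ 0 → (∑ k, q i k * L j k)
      + (∑ k, ∑ l, L i k * b x k l m * L j l) = 0) :
    P = L * mA a m x * L - mB a m x - L * mW b m x := by
  have e : ∀ i j, (∑ k, q i k * L j k) = (P * Lᵀ) i j := by
    intro i j
    simp only [hq, Matrix.mul_apply, Matrix.transpose_apply]
  simp only [e, LWL_entry] at h1 h2
  exact alg_to a b m x L P hL hW hs h1 h2

theorem alg_from2 (a : (Fin n → ℝ) → Fin n → Fin n → ℝ)
    (b : (Fin n → ℝ) → Fin n → Fin n → Fin n → ℝ) (m : Fin n) (x : Fin n → ℝ)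
    (L P : Matrix (Fin n) (Fin n) ℝ) (q : Fin n → Fin n → ℝ) (hq : ∀ i k, q i k = P i k)
    (hL : L * Lᵀ = 1)
    (hP : P = L * mA a m x * L - mB a m x - L * mW b m x) (i j : Fin n) :
    (∑ k, q i k * L j k) + (∑ k, ∑ l, L i k * b x k l m * L j l) =
      (∑ k, L i k * a x k m) * (Pi.single 0 1 : Fin n → ℝ) j
        - (Pi.single 0 1 : Fin n → ℝ) i * (∑ k, L j k * a x k m) := by
  have h1 := congrFun (congrFun (alg_from a b m x L P hL hP) i) j
  rw [Matrix.sub_apply, LA_entry, BL_entry] at h1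
  rw [← h1, LWL_entry, Matrix.add_apply]
  simp only [hq]
  rfl

end algp

/-- Matrices with the operator norm, as a type with a single set of instances. -/
def MM (n : ℕ) : Type := Matrix (Fin n) (Fin n) ℝ

noncomputable instance MM.nr (n : ℕ) : NormedRing (MM n) :=
  (Matrix.linftyOpNormedRing : NormedRing (Matrix (Fin n) (Fin n) ℝ))

noncomputable instance MM.na (n : ℕ) : NormedAlgebra ℝ (MM n) :=
  letI : NormedRing (Matrix (Fin n) (Fin n) ℝ) := Matrix.linftyOpNormedRing
  (Matrix.linftyOpNormedAlgebra : NormedAlgebra ℝ (Matrix (Fin n) (Fin n) ℝ))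

instance MM.fd (n : ℕ) : FiniteDimensional ℝ (MM n) :=
  (inferInstance : FiniteDimensional ℝ (Matrix (Fin n) (Fin n) ℝ))

section matp
open Set Metric Topology
variable {n : ℕ}

noncomputable def entL (i k : Fin n) : MM n →L[ℝ] ℝ :=
  LinearMap.toContinuousLinearMap
    { toFun := fun M => M i k
      map_add' := fun _ _ => rfl
      map_smul' := fun _ _ => rfl }

noncomputable def trL : MM n →L[ℝ] MM n :=
  LinearMap.toContinuousLinearMap
    { toFun := fun M => (Matrix.transpose M : Matrix (Fin n) (Fin n) ℝ)
      map_add' := fun _ _ => rfl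
      map_smul' := fun _ _ => rfl }

theorem trL_mul (x y : MM n) : trL (x * y) = trL y * trL x :=
  Matrix.transpose_mul (M := (x : Matrix (Fin n) (Fin n) ℝ)) (N := y)

theorem trL_trL (x : MM n) : trL (trL x) = x := rfl

theorem mat_contDiffAt {c : WithTop ℕ∞} {M : (Fin n → ℝ) → MM n}
    {x : Fin n → ℝ} (h : ∀ i k, ContDiffAt ℝ c (fun y => M y i k) x) : ContDiffAt ℝ c M x := by
  let sg : Fin n → Fin n → MM n := fun i k => Matrix.single i k (1:ℝ)
  have key : ∀ N : Matrix (Fin n) (Fin n) ℝ,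
      N = ∑ i, ∑ k, N i k • Matrix.single i k (1:ℝ) := by
    intro N
    conv_lhs => rw [Matrix.matrix_eq_sum_single N]
    simp
  have e : M = fun y => ∑ i, ∑ k, M y i k • sg i k := by
    funext y
    exact key (M y)
  rw [e]
  exact ContDiffAt.sum fun i _ => ContDiffAt.sum fun k _ => (h i k).smul contDiffAt_const

theorem mat_fderiv {M : (Fin n → ℝ) → MM n} {x : Fin n → ℝ}
    {D : (Fin n → ℝ) →L[ℝ] MM n}
    (h : HasFDerivAt M D x) (i k m : Fin n) :
    pd m (fun y => M y i k) x = D (Pi.single m 1) i k := by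
  have h1 : HasFDerivAt (fun y => M y i k) ((entL i k).comp D) x :=
    (entL i k).hasFDerivAt.comp x h
  unfold pd
  rw [h1.fderiv]
  rfl

variable [NeZero n]

def nA (a : (Fin n → ℝ) → Fin n → Fin n → ℝ) (m : Fin n) (x : Fin n → ℝ) : MM n := mA a m x
def nB (a : (Fin n → ℝ) → Fin n → Fin n → ℝ) (m : Fin n) (x : Fin n → ℝ) : MM n := mB a m x
def nW (b : (Fin n → ℝ) → Fin n → Fin n → Fin n → ℝ) (m : Fin n) (x : Fin n → ℝ) : MM n :=
  mW b m x

theorem frame_to (a : (Fin n → ℝ) → Fin n → Fin n → ℝ)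
    (b : (Fin n → ℝ) → Fin n → Fin n → Fin n → ℝ) (V : Set (Fin n → ℝ)) (hV : IsOpen V)
    (hskew : ∀ x ∈ V, ∀ i j m, b x i j m = -b x j i m)
    (L : (Fin n → ℝ) → MM n) (hL : FrameSol a b L V) :
    ∀ x ∈ V, HasFDerivAt L (ricF (nA a) (nB a) (nW b) (x, L x)) x := by
  intro x hx
  obtain ⟨h1, h2, h3, h4⟩ := hL
  have hLs : ContDiffAt ℝ (⊤ : ℕ∞) L x :=
    mat_contDiffAt fun i k => (h1 i k).contDiffAt (hV.mem_nhds hx)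
  have hLd : HasFDerivAt L (fderiv ℝ L x) x := (hLs.differentiableAt (by simp)).hasFDerivAt
  refine hLd.congr_fderiv ?_
  apply clm_ext_single
  intro m
  refine Eq.trans ?_ (ricF_single (nA a) (nB a) (nW b) (x, L x) m).symm
  exact alg_to2 a b m x (L x) (fderiv ℝ L x (Pi.single m 1)) (fun i k => pd m (fun y => L y i k) x)
    (fun i k => mat_fderiv hLd i k m) (h2 x hx) (W_skew b x (hskew x hx) m)
    (abs_fderiv_one trL V hV L x hx _ hLd h2 (Pi.single m 1)) (h3 x hx m) (h4 x hx m)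

theorem frame_from (a : (Fin n → ℝ) → Fin n → Fin n → ℝ)
    (b : (Fin n → ℝ) → Fin n → Fin n → Fin n → ℝ) (V : Set (Fin n → ℝ))
    (L : (Fin n → ℝ) → MM n)
    (hs : ContDiffOn ℝ (⊤ : ℕ∞) L V) (ho : ∀ x ∈ V, L x * trL (L x) = 1)
    (hL : ∀ x ∈ V, HasFDerivAt L (ricF (nA a) (nB a) (nW b) (x, L x)) x) :
    FrameSol a b L V := by
  have key : ∀ x ∈ V, ∀ m i j, (∑ k, pd m (fun y => L y i k) x * L x j k)
      + (∑ k, ∑ l, L x i k * b x k l m * L x j l) =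
      (∑ k, L x i k * a x k m) * (Pi.single 0 1 : Fin n → ℝ) j
        - (Pi.single 0 1 : Fin n → ℝ) i * (∑ k, L x j k * a x k m) := by
    intro x hx m i j
    exact alg_from2 a b m x (L x) _ (fun i k => pd m (fun y => L y i k) x)
      (fun i k => mat_fderiv (hL x hx) i k m) (ho x hx)
      (ricF_single (nA a) (nB a) (nW b) (x, L x) m) i j
  refine ⟨fun i k => (entL i k).contDiff.comp_contDiffOn hs, ho, ?_, ?_⟩
  · intro x hx m i hi
    rw [key x hx]
    simp [hi]
  · intro x hx m i j hij hi hj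
    rw [key x hx]
    simp [hi, hj]

theorem frame_main (U : Set (Fin n → ℝ)) (hU : IsOpen U)
    (a : (Fin n → ℝ) → Fin n → Fin n → ℝ)
    (b : (Fin n → ℝ) → Fin n → Fin n → Fin n → ℝ)
    (ha : ∀ i k, ContDiffOn ℝ (⊤ : ℕ∞) (fun x => a x i k) U)
    (hb : ∀ i j m, ContDiffOn ℝ (⊤ : ℕ∞) (fun x => b x i j m) U)
    (hskew : ∀ x ∈ U, ∀ i j m, b x i j m = -b x j i m)
    (hstruct1 : ∀ x ∈ U, ∀ i l m,
      pd l (fun y => a y i m) x - pd m (fun y => a y i l) x =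
        ∑ j, (a x j l * b x j i m - a x j m * b x j i l))
    (hstruct2 : ∀ x ∈ U, ∀ i j l m,
      pd l (fun y => b y i j m) x - pd m (fun y => b y i j l) x =
        (∑ k, (b x i k l * b x k j m - b x i k m * b x k j l))
          + a x i l * a x j m - a x i m * a x j l)
    (x₀ : Fin n → ℝ) (hx₀ : x₀ ∈ U) (L₀ : Matrix (Fin n) (Fin n) ℝ) (hL₀ : L₀ * L₀ᵀ = 1) :
      (∃ V : Set (Fin n → ℝ), IsOpen V ∧ x₀ ∈ V ∧ V ⊆ U ∧
        ∃ L : (Fin n → ℝ) → Matrix (Fin n) (Fin n) ℝ,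
          L x₀ = L₀ ∧ FrameSol a b L V) ∧
      (∀ W : Set (Fin n → ℝ), IsOpen W → IsConnected W → x₀ ∈ W → W ⊆ U →
        ∀ L L' : (Fin n → ℝ) → Matrix (Fin n) (Fin n) ℝ,
          FrameSol a b L W → FrameSol a b L' W → L x₀ = L' x₀ →
          ∀ x ∈ W, L x = L' x) := by
  have ha' : ∀ x ∈ U, ∀ i k, ContDiffAt ℝ (⊤ : ℕ∞) (fun x => a x i k) x := fun x hx i k =>
    (ha i k).contDiffAt (hU.mem_nhds hx)
  have hAs : ∀ x ∈ U, ∀ m, ContDiffAt ℝ (⊤ : ℕ∞) (nA a m) x := fun x hx m =>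
    mat_contDiffAt fun i k => (ha' x hx i m).mul contDiffAt_const
  have hBs : ∀ x ∈ U, ∀ m, ContDiffAt ℝ (⊤ : ℕ∞) (nB a m) x := fun x hx m =>
    mat_contDiffAt fun i k => contDiffAt_const.mul (ha' x hx k m)
  have hWs : ∀ x ∈ U, ∀ m, ContDiffAt ℝ (⊤ : ℕ∞) (nW b m) x := fun x hx m =>
    mat_contDiffAt fun i k => (hb i k m).contDiffAt (hU.mem_nhds hx)
  have hAd : ∀ x ∈ U, ∀ m, DifferentiableAt ℝ (nA a m) x := fun x hx m =>
    (hAs x hx m).differentiableAt (by simp)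
  have hBd : ∀ x ∈ U, ∀ m, DifferentiableAt ℝ (nB a m) x := fun x hx m =>
    (hBs x hx m).differentiableAt (by simp)
  have hWd : ∀ x ∈ U, ∀ m, DifferentiableAt ℝ (nW b m) x := fun x hx m =>
    (hWs x hx m).differentiableAt (by simp)
  have had : ∀ x ∈ U, ∀ i k, DifferentiableAt ℝ (fun x => a x i k) x := fun x hx i k =>
    (ha' x hx i k).differentiableAt (by simp)
  have hpA : ∀ x ∈ U, ∀ l m i k, fderiv ℝ (nA a m) x (Pi.single l 1) i k =
      pd l (fun y => a y i m) x * (Pi.single 0 1 : Fin n → ℝ) k := by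
    intro x hx l m i k
    refine (mat_fderiv (hAd x hx m).hasFDerivAt i k l).symm.trans ?_
    change fderiv ℝ (fun y => a y i m * (Pi.single 0 1 : Fin n → ℝ) k) x (Pi.single l 1) = _
    rw [fderiv_mul_const (had x hx i m)]
    simp [pd, mul_comm]
  have hpB : ∀ x ∈ U, ∀ l m i k, fderiv ℝ (nB a m) x (Pi.single l 1) i k =
      (Pi.single 0 1 : Fin n → ℝ) i * pd l (fun y => a y k m) x := by
    intro x hx l m i k
    refine (mat_fderiv (hBd x hx m).hasFDerivAt i k l).symm.trans ?_
    change fderiv ℝ (fun y => (Pi.single 0 1 : Fin n → ℝ) i * a y k m) x (Pi.single l 1) = _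
    rw [fderiv_const_mul (had x hx k m)]
    simp [pd]
  have hpW : ∀ x ∈ U, ∀ l m i k, fderiv ℝ (nW b m) x (Pi.single l 1) i k =
      pd l (fun y => b y i k m) x := by
    intro x hx l m i k
    refine (mat_fderiv (hWd x hx m).hasFDerivAt i k l).symm.trans ?_
    rfl
  constructor
  · have : CompleteSpace (MM n) := FiniteDimensional.complete ℝ _
    obtain ⟨V, hV, hxV, hVU, L, hL0, hLs, hLo, hLd⟩ := abs_exists trL trL_mul trL_trL
      (nA a) (nB a) (nW b) U hU (fun x _ m => mA_t a m x)
      (fun x hx m => W_skew b x (hskew x hx) m) hAs hBs hWs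
      (by
        intro x hx l m
        apply Matrix.ext
        intro i k
        change fderiv ℝ (nA a m) x (Pi.single l 1) i k - fderiv ℝ (nA a l) x (Pi.single m 1) i k
          = (mW b l x * mA a m x - mW b m x * mA a l x) i k
        rw [hpA x hx, hpA x hx, ← sub_mul, hstruct1 x hx, Matrix.sub_apply,
          Matrix.mul_apply, Matrix.mul_apply, ← Finset.sum_sub_distrib, Finset.sum_mul]
        refine Finset.sum_congr rfl fun j _ => ?_
        simp only [mA, mW, Matrix.vecMulVec_apply, Matrix.of_apply]
        rw [hskew x hx j i m, hskew x hx j i l]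
        ring)
      (by
        intro x hx l m
        apply Matrix.ext
        intro i k
        change fderiv ℝ (nB a m) x (Pi.single l 1) i k - fderiv ℝ (nB a l) x (Pi.single m 1) i k
          = (mB a l x * mW b m x - mB a m x * mW b l x) i k
        rw [hpB x hx, hpB x hx, ← mul_sub, hstruct1 x hx, Matrix.sub_apply,
          Matrix.mul_apply, Matrix.mul_apply, ← Finset.sum_sub_distrib, Finset.mul_sum]
        refine Finset.sum_congr rfl fun j _ => ?_
        simp only [mB, mW, Matrix.vecMulVec_apply, Matrix.of_apply]
        ring)
      (by
        intro x hx l m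
        apply Matrix.ext
        intro i k
        have hAB : ∀ l m, (mA a l x * mB a m x) i k = a x i l * a x k m := by
          intro l m
          simp only [mA, mB, Matrix.mul_apply, Matrix.vecMulVec_apply]
          rw [Finset.sum_eq_single 0]
          · simp
          · intro j _ hj; simp [hj]
          · simp
        change fderiv ℝ (nW b m) x (Pi.single l 1) i k - fderiv ℝ (nW b l) x (Pi.single m 1) i k
          = (mW b l x * mW b m x - mW b m x * mW b l x + mA a l x * mB a m x
            - mA a m x * mB a l x) i k
        rw [hpW x hx, hpW x hx, hstruct2 x hx, Matrix.sub_apply, Matrix.add_apply,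
          Matrix.sub_apply, hAB, hAB, Finset.sum_sub_distrib]
        rfl)
      (by
        intro x hx l m
        apply Matrix.ext
        intro i k
        change (mB a l x * mA a m x) i k = (mB a m x * mA a l x) i k
        simp only [mA, mB, Matrix.mul_apply, Matrix.vecMulVec_apply]
        refine Finset.sum_congr rfl fun j _ => ?_
        ring)
      x₀ hx₀ L₀ hL₀
    exact ⟨V, hV, hxV, hVU, L, hL0, frame_from a b V L hLs hLo hLd⟩
  · intro W hW hWc hxW hWU L L' hL hL' h0
    exact abs_unique (R := MM n) (nA a) (nB a) (nW b) W hW hWc.isPreconnected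
      (fun x hx => hAs x (hWU hx)) (fun x hx => hBs x (hWU hx)) (fun x hx => hWs x (hWU hx)) L L'
      (frame_to a b W hW (fun x hx => hskew x (hWU hx)) L hL)
      (frame_to a b W hW (fun x hx => hskew x (hWU hx)) L' hL') x₀ hxW h0
end matp

theorem statement14 (n : ℕ) (hn : 2 ≤ n) [NeZero n]
    (U : Set (Fin n → ℝ)) (hU : IsOpen U)
    (a : (Fin n → ℝ) → Fin n → Fin n → ℝ)
    (b : (Fin n → ℝ) → Fin n → Fin n → Fin n → ℝ)
    (ha : ∀ i k, ContDiffOn ℝ (⊤ : ℕ∞) (fun x => a x i k) U)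
    (hb : ∀ i j m, ContDiffOn ℝ (⊤ : ℕ∞) (fun x => b x i j m) U)
    (hskew : ∀ x ∈ U, ∀ i j m, b x i j m = -b x j i m)
    (hstruct1 : ∀ x ∈ U, ∀ i l m,
      pd l (fun y => a y i m) x - pd m (fun y => a y i l) x =
        ∑ j, (a x j l * b x j i m - a x j m * b x j i l))
    (hstruct2 : ∀ x ∈ U, ∀ i j l m,
      pd l (fun y => b y i j m) x - pd m (fun y => b y i j l) x =
        (∑ k, (b x i k l * b x k j m - b x i k m * b x k j l))
          + a x i l * a x j m - a x i m * a x j l)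
    (hainv : ∀ x ∈ U, IsUnit (Matrix.of (fun i k => a x i k) : Matrix (Fin n) (Fin n) ℝ)) :
    ∀ x₀ ∈ U, ∀ L₀ : Matrix (Fin n) (Fin n) ℝ, L₀ * L₀ᵀ = 1 →
      (∃ V : Set (Fin n → ℝ), IsOpen V ∧ x₀ ∈ V ∧ V ⊆ U ∧
        ∃ L : (Fin n → ℝ) → Matrix (Fin n) (Fin n) ℝ,
          L x₀ = L₀ ∧ FrameSol a b L V) ∧
      (∀ W : Set (Fin n → ℝ), IsOpen W → IsConnected W → x₀ ∈ W → W ⊆ U →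
        ∀ L L' : (Fin n → ℝ) → Matrix (Fin n) (Fin n) ℝ,
          FrameSol a b L W → FrameSol a b L' W → L x₀ = L' x₀ →
          ∀ x ∈ W, L x = L' x) := by
  exact fun x₀ hx₀ L₀ hL₀ =>
    frame_main U hU a b ha hb hskew hstruct1 hstruct2 x₀ hx₀ L₀ hL₀
end

section
/- Let n ≥ 2, let U ⊆ ℝⁿ be open, and let {V, h} be a smooth solution of the Intrinsic Generalized sine-Gordon equation on U. Let L : U → Matrix (n×n, ℝ) be smooth with L(x) L(x)ᵀ = I for all x ∈ U, and suppose that for every coordinate index m (writing b_{klm} := h_{kl} δ_{lm} − h_{lk} δ_{km} for k ≠ l and b_{kkm} := 0): Σ_k (∂_m L_{1k}) L_{ik} + Σ_{k,l} L_{1k} b_{klm} L_{il} + L_{im} V_m = 0 for every i ≠ 1, and Σ_k (∂_m L_{ik}) L_{jk} + Σ_{k,l} L_{ik} b_{klm} L_{jl} = 0 for all distinct i, j with i ≠ 1, j ≠ 1. Then ∂_l (L_{1m} V_m) = ∂_m (L_{1l} V_l) for all l, m; in particular, regarding x₁ as the time variable t, one has ∂/∂t (L_{1k} V_k) = ∂/∂x_k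 (L_{11} V₁) for every k ≥ 2, giving n − 1 conservation laws for the Intrinsic Generalized sine-Gordon equation. -/
open Real Matrix

/-- The Intrinsic Generalized sine-Gordon equations for the pair `{V, h}` on `U`. -/
def IGSGE (n : ℕ) (U : Set (Fin n → ℝ)) (V : (Fin n → ℝ) → Fin n → ℝ)
    (h : (Fin n → ℝ) → Fin n → Fin n → ℝ) : Prop :=
  ∀ x ∈ U,
    (∑ i, V x i ^ 2 = 1) ∧
    (∀ i j, i ≠ j → pd j (fun y => V y i) x = V x j * h x j i) ∧
    (∀ i j, i ≠ j →
      pd i (fun y => h y i j) x + pd j (fun y => h y j i) x +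
        ∑ s ∈ Finset.univ.filter (fun s => s ≠ i ∧ s ≠ j), h x s i * h x s j
      = V x i * V x j) ∧
    (∀ i j s : Fin n, i ≠ j → i ≠ s → j ≠ s →
      pd s (fun y => h y i j) x = h x i s * h x s j)

/-- The coefficients `b_{klm} = h_{kl} δ_{lm} - h_{lk} δ_{km}` for `k ≠ l`, `b_{kkm} = 0`,
of the connection forms `ω_{kl} = h_{kl} dx_l - h_{lk} dx_k`. -/
def bIG {n : ℕ} (h : (Fin n → ℝ) → Fin n → Fin n → ℝ)
    (x : Fin n → ℝ) (k l m : Fin n) : ℝ :=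
  if k = l then 0
  else (if l = m then h x k l else 0) - (if k = m then h x l k else 0)

lemma key_pd {n : ℕ} [NeZero n] (h : (Fin n → ℝ) → Fin n → Fin n → ℝ) (x : Fin n → ℝ)
    (A : Matrix (Fin n) (Fin n) ℝ) (hA : A * Aᵀ = 1) (D : Fin n → ℝ) (m : Fin n) (v : ℝ)
    (h0 : ∑ k, D k * A 0 k = 0)
    (hi : ∀ i : Fin n, i ≠ 0 →
      (∑ k, D k * A i k) + (∑ k, ∑ l, A 0 k * bIG h x k l m * A i l) + A i m * v = 0)
    (l : Fin n) (hlm : l ≠ m) :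
    D l = A 0 l * A 0 m * v + A 0 m * h x l m := by
  have hb : ∀ k l, bIG h x k l m = - bIG h x l k m := by
    intro k l
    unfold bIG
    by_cases hkl : k = l
    · simp [hkl]
    · rw [if_neg hkl, if_neg (Ne.symm hkl)]; ring
  have hs : (∑ k, ∑ l, A 0 k * bIG h x k l m * A 0 l) = 0 := by
    have h1 : (∑ k, ∑ l, A 0 k * bIG h x k l m * A 0 l)
        = - (∑ k, ∑ l, A 0 k * bIG h x k l m * A 0 l) := by
      conv_lhs => rw [Finset.sum_comm]
      rw [← Finset.sum_neg_distrib]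
      refine Finset.sum_congr rfl fun k _ => ?_
      rw [← Finset.sum_neg_distrib]
      refine Finset.sum_congr rfl fun l _ => ?_
      rw [hb l k]; ring
    linarith
  let u : Fin n → ℝ := fun k => D k + (∑ p, A 0 p * bIG h x p k m) + (if k = m then v else 0)
  have hu : ∀ i, (A *ᵥ u) i = (∑ k, D k * A i k)
      + (∑ k, ∑ l, A 0 k * bIG h x k l m * A i l) + A i m * v := by
    intro i
    simp only [Matrix.mulVec, dotProduct, u, mul_add, Finset.sum_add_distrib]
    congr 1
    · congr 1
      · exact Finset.sum_congr rfl fun k _ => mul_comm _ _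
      · rw [Finset.sum_comm (f := fun k l => A 0 k * bIG h x k l m * A i l)]
        refine Finset.sum_congr rfl fun k _ => ?_
        rw [Finset.mul_sum]
        exact Finset.sum_congr rfl fun k _ => mul_comm _ _
    · simp
  have hAu : A *ᵥ u = Pi.single 0 (A 0 m * v) := by
    funext i
    rw [hu i]
    by_cases hi0 : i = 0
    · subst hi0
      rw [h0, hs]; simp
    · rw [hi i hi0]; simp [hi0]
  have hA' : Aᵀ * A = 1 := mul_eq_one_comm.mp hA
  have hu2 : u = Aᵀ *ᵥ (Pi.single 0 (A 0 m * v)) := by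
    rw [← hAu, Matrix.mulVec_mulVec, hA', Matrix.one_mulVec]
  have h3 := congrFun hu2 l
  have h4 : (∑ p, A 0 p * bIG h x p l m) = - (A 0 m * h x l m) := by
    rw [Finset.sum_eq_single m]
    · simp [bIG, hlm, Ne.symm hlm]
    · intro p _ hp
      simp [bIG, hlm, hp]
    · simp
  simp only [u, h4, if_neg hlm, Matrix.mulVec_single] at h3
  simp at h3
  linarith

theorem statement15 (n : ℕ) (hn : 2 ≤ n) [NeZero n]
    (U : Set (Fin n → ℝ)) (hU : IsOpen U)
    (V : (Fin n → ℝ) → Fin n → ℝ) (h : (Fin n → ℝ) → Fin n → Fin n → ℝ)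
    (hV : ∀ i, ContDiffOn ℝ (⊤ : ℕ∞) (fun x => V x i) U)
    (hh : ∀ i j, ContDiffOn ℝ (⊤ : ℕ∞) (fun x => h x i j) U)
    (hsol : IGSGE n U V h)
    (L : (Fin n → ℝ) → Matrix (Fin n) (Fin n) ℝ)
    (hL : ∀ i k, ContDiffOn ℝ (⊤ : ℕ∞) (fun x => L x i k) U)
    (horth : ∀ x ∈ U, L x * (L x)ᵀ = 1)
    (heqA : ∀ x ∈ U, ∀ m : Fin n, ∀ i : Fin n, i ≠ 0 →
      (∑ k, pd m (fun y => L y 0 k) x * L x i k)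
        + (∑ k, ∑ l, L x 0 k * bIG h x k l m * L x i l)
        + L x i m * V x m = 0)
    (heqB : ∀ x ∈ U, ∀ m : Fin n, ∀ i j : Fin n, i ≠ j → i ≠ 0 → j ≠ 0 →
      (∑ k, pd m (fun y => L y i k) x * L x j k)
        + (∑ k, ∑ l, L x i k * bIG h x k l m * L x j l) = 0) :
    (∀ x ∈ U, ∀ l m : Fin n,
      pd l (fun y => L y 0 m * V y m) x = pd m (fun y => L y 0 l * V y l) x) ∧
    (∀ x ∈ U, ∀ k : Fin n, k ≠ 0 →
      pd 0 (fun y => L y 0 k * V y k) x = pd k (fun y => L y 0 0 * V y 0) x) := by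
  have hd : ∀ {f : (Fin n → ℝ) → ℝ}, ContDiffOn ℝ (⊤ : ℕ∞) f U → ∀ x ∈ U,
      DifferentiableAt ℝ f x := fun hf x hx =>
    (hf.contDiffAt (hU.mem_nhds hx)).differentiableAt (by simp)
  have hmul : ∀ {f g : (Fin n → ℝ) → ℝ} {x}, DifferentiableAt ℝ f x → DifferentiableAt ℝ g x →
      ∀ m, pd m (fun y => f y * g y) x = f x * pd m g x + g x * pd m f x := by
    intro f g x hf hg m
    simp only [pd]
    rw [fderiv_fun_mul hf hg]
    simp
  have main : ∀ x ∈ U, ∀ l m : Fin n, l ≠ m → pd m (fun y => L y 0 l) x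
      = L x 0 l * L x 0 m * V x m + L x 0 m * h x l m := by
    intro x hx l m hlm
    refine key_pd h x (L x) (horth x hx) (fun k => pd m (fun y => L y 0 k) x) m (V x m) ?_
      (heqA x hx m) l hlm
    have hc : (fun y => ∑ k, L y 0 k * L y 0 k) =ᶠ[nhds x] fun _ => (1 : ℝ) := by
      filter_upwards [hU.mem_nhds hx] with y hy
      have := congrFun (congrFun (horth y hy) 0) 0
      simpa [Matrix.mul_apply] using this
    have h1 : pd m (fun y => ∑ k, L y 0 k * L y 0 k) x = 0 := by
      simp only [pd]
      rw [hc.fderiv_eq]; simp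
    have h2 : pd m (fun y => ∑ k, L y 0 k * L y 0 k) x
        = ∑ k, pd m (fun y => L y 0 k * L y 0 k) x := by
      simp only [pd]
      rw [fderiv_fun_sum (A := fun k y => L y 0 k * L y 0 k)
        fun k _ => (hd (hL 0 k) x hx).fun_mul (hd (hL 0 k) x hx)]
      simp
    have h3 : ∑ k, pd m (fun y => L y 0 k * L y 0 k) x
        = 2 * ∑ k, pd m (fun y => L y 0 k) x * L x 0 k := by
      rw [Finset.mul_sum]
      refine Finset.sum_congr rfl fun k _ => ?_
      rw [hmul (hd (hL 0 k) x hx) (hd (hL 0 k) x hx)]; ring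
    linarith
  have fin : ∀ x ∈ U, ∀ l m : Fin n,
      pd l (fun y => L y 0 m * V y m) x = pd m (fun y => L y 0 l * V y l) x := by
    intro x hx l m
    by_cases hlm : l = m
    · rw [hlm]
    · rw [hmul (hd (hL 0 m) x hx) (hd (hV m) x hx), hmul (hd (hL 0 l) x hx) (hd (hV l) x hx),
        main x hx l m hlm, main x hx m l (Ne.symm hlm),
        (hsol x hx).2.1 l m hlm, (hsol x hx).2.1 m l (Ne.symm hlm)]
      ring
  exact ⟨fin, fun x hx k _ => fin x hx 0 k⟩
end

section
/- Let n ≥ 2, let U ⊆ ℝⁿ be open, and let {V, h} be a smooth solution of the Intrinsic Generalized sine-Gordon equation on U with Vᵢ(x) ≠ 0 for all i and all x ∈ U. Then for every x⁰ ∈ U and every orthogonal matrix L⁰ (L⁰ (L⁰)ᵀ = I) there exist an open neighborhood W ⊆ U of x⁰ and a smooth map L : W → Matrix (n×n, ℝ) with L(x⁰) = L⁰ and L(x) L(x)ᵀ = I for all x ∈ W such that, writing b_{klm} := h_{kl} δ_{lm} − h_{lk} δ_{km} for k ≠ l and b_{kkm} := 0, for every coordinate index m: Σ_k (∂_m L_{1k})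 L_{ik} + Σ_{k,l} L_{1k} b_{klm} L_{il} + L_{im} V_m = 0 for every i ≠ 1, and Σ_k (∂_m L_{ik}) L_{jk} + Σ_{k,l} L_{ik} b_{klm} L_{jl} = 0 for all distinct i, j with i ≠ 1, j ≠ 1; moreover any two such maps on a connected open neighborhood of x⁰ agreeing at x⁰ coincide. -/
open Real Matrix

/-- `L` is a smooth orthogonal solution on `W` of the frame system associated to a
solution `{V, h}` of the IGSGE, written coefficientwise. -/
def IGFrameSol {n : ℕ} [NeZero n]
    (V : (Fin n → ℝ) → Fin n → ℝ) (h : (Fin n → ℝ) → Fin n → Fin n → ℝ)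
    (L : (Fin n → ℝ) → Matrix (Fin n) (Fin n) ℝ)
    (W : Set (Fin n → ℝ)) : Prop :=
  (∀ i k, ContDiffOn ℝ (⊤ : ℕ∞) (fun x => L x i k) W) ∧
  (∀ x ∈ W, L x * (L x)ᵀ = 1) ∧
  (∀ x ∈ W, ∀ m : Fin n, ∀ i : Fin n, i ≠ 0 →
    (∑ k, pd m (fun y => L y 0 k) x * L x i k)
      + (∑ k, ∑ l, L x 0 k * bIG h x k l m * L x i l)
      + L x i m * V x m = 0) ∧
  (∀ x ∈ W, ∀ m : Fin n, ∀ i j : Fin n, i ≠ j → i ≠ 0 → j ≠ 0 →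
    (∑ k, pd m (fun y => L y i k) x * L x j k)
      + (∑ k, ∑ l, L x i k * bIG h x k l m * L x j l) = 0)

set_option maxSynthPendingDepth 4

section frob
variable {E F : Type*} [NormedAddCommGroup E] [NormedSpace ℝ E]
  [NormedAddCommGroup F] [NormedSpace ℝ F]

lemma frob_ray [CompleteSpace F] (A : E → E →L[ℝ] F →L[ℝ] F) (x₀ : E) (R C : ℝ) (hC : 0 ≤ C)
    (hRC : R * C ≤ 1 / 2)
    (hcont : ContinuousOn A (Metric.ball x₀ R)) (hA : ∀ x ∈ Metric.ball x₀ R, ‖A x‖ ≤ C)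
    (y₀ : F) (v : E) (hv : ‖v‖ < R) :
    ∃ y : ℝ → F, y 0 = y₀ ∧ ∀ t ∈ Set.Icc (0:ℝ) 1,
      HasDerivWithinAt y (A (x₀ + t • v) v (y t)) (Set.Icc 0 1) t := by
  have hR : 0 < R := lt_of_le_of_lt (norm_nonneg _) hv
  have hmem : ∀ t ∈ Set.Icc (0:ℝ) 1, x₀ + t • v ∈ Metric.ball x₀ R := by
    intro t ht
    rw [Metric.mem_ball, dist_eq_norm, add_sub_cancel_left, norm_smul, Real.norm_of_nonneg ht.1]
    nlinarith [ht.2, norm_nonneg v]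
  have hop : ∀ t ∈ Set.Icc (0:ℝ) 1, ‖A (x₀ + t • v) v‖ ≤ 1 / 2 := by
    intro t ht
    calc ‖A (x₀ + t • v) v‖ ≤ ‖A (x₀ + t • v)‖ * ‖v‖ := ContinuousLinearMap.le_opNorm _ _
      _ ≤ C * R := mul_le_mul (hA _ (hmem t ht)) hv.le (norm_nonneg _) hC
      _ ≤ 1 / 2 := by linarith
  have hPL : IsPicardLindelof (fun t y => A (x₀ + t • v) v y) (tmin := 0) (tmax := 1)
      ⟨0, by simp⟩ y₀ (‖y₀‖₊ + 1) 0 (‖y₀‖₊ + 1) 1 := by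
    refine ⟨?_, ?_, ?_, ?_⟩
    · intro t ht
      apply LipschitzWith.lipschitzOnWith
      apply ((A (x₀ + t • v) v).lipschitz).weaken
      have := hop t ht
      rw [← NNReal.coe_le_coe]
      simp only [coe_nnnorm, NNReal.coe_one]
      linarith
    · intro x _
      have : ContinuousOn (fun t : ℝ => A (x₀ + t • v)) (Set.Icc 0 1) :=
        hcont.comp (by fun_prop) hmem
      exact (this.clm_apply continuousOn_const).clm_apply continuousOn_const
    · intro t ht x hx
      have h1 : ‖x‖ ≤ ‖y₀‖ + (‖y₀‖ + 1) := by
        have := Metric.mem_closedBall.1 hx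
        rw [dist_eq_norm] at this
        have h2 := norm_add_le y₀ (x - y₀)
        rw [add_sub_cancel] at h2
        simp only [NNReal.coe_add, coe_nnnorm, NNReal.coe_one] at this
        linarith
      calc ‖A (x₀ + t • v) v x‖ ≤ ‖A (x₀ + t • v) v‖ * ‖x‖ := ContinuousLinearMap.le_opNorm _ _
        _ ≤ 1 / 2 * (‖y₀‖ + (‖y₀‖ + 1)) :=
          mul_le_mul (hop t ht) h1 (norm_nonneg _) (by norm_num)
        _ ≤ _ := by simp only [NNReal.coe_add, coe_nnnorm, NNReal.coe_one]; linarith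
    · simp
  obtain ⟨y, hy, hy'⟩ := hPL.exists_eq_forall_mem_Icc_hasDerivWithinAt₀
  exact ⟨y, hy, hy'⟩

lemma frob_taylor (A : E → E →L[ℝ] F →L[ℝ] F) (A' : E → E →L[ℝ] E →L[ℝ] F →L[ℝ] F)
    (x₀ : E) (R C : ℝ) 
    (hd : ∀ x ∈ Metric.ball x₀ R, HasFDerivAt A (A' x) x)
    (hL : ∀ x ∈ Metric.ball x₀ R, ∀ y ∈ Metric.ball x₀ R, ‖A' x - A' y‖ ≤ C * ‖x - y‖) (hC : 0 ≤ C)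
    (x y : E) (hx : x ∈ Metric.ball x₀ R) (hy : y ∈ Metric.ball x₀ R) :
    ‖A y - A x - A' x (y - x)‖ ≤ C * ‖y - x‖ ^ 2 := by
  have hs : segment ℝ x y ⊆ Metric.ball x₀ R := (convex_ball x₀ R).segment_subset hx hy
  have := Convex.norm_image_sub_le_of_norm_hasFDerivWithin_le' (f := A) (f' := A') (φ := A' x)
    (s := segment ℝ x y) (C := C * ‖y - x‖) (x := x) (y := y)
    (fun z hz => (hd z (hs hz)).hasFDerivWithinAt) (fun z hz => by
      refine (hL z (hs hz) x hx).trans ?_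
      gcongr
      obtain ⟨θ, hθ, rfl⟩ := (segment_eq_image' ℝ x y ▸ hz)
      rw [add_sub_cancel_left, norm_smul, Real.norm_of_nonneg hθ.1]
      nlinarith [norm_nonneg (y - x), hθ.2]) (convex_segment x y) (left_mem_segment _ _ _)
      (right_mem_segment _ _ _)
  linarith

lemma frob_est (A : E → E →L[ℝ] F →L[ℝ] F) (A' : E → E →L[ℝ] E →L[ℝ] F →L[ℝ] F)
    (x₀ : E) (R C : ℝ) (hC : 1 ≤ C) (hR1 : R ≤ 1)
    (hd : ∀ x ∈ Metric.ball x₀ R, HasFDerivAt A (A' x) x)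
    (hA : ∀ x ∈ Metric.ball x₀ R, ‖A x‖ ≤ C)
    (hA' : ∀ x ∈ Metric.ball x₀ R, ‖A' x‖ ≤ C)
    (hL : ∀ x ∈ Metric.ball x₀ R, ∀ y ∈ Metric.ball x₀ R, ‖A' x - A' y‖ ≤ C * ‖x - y‖)
    (hflat : ∀ x ∈ Metric.ball x₀ R, ∀ v w y, A' x v w y + A x w (A x v y)
      = A' x w v y + A x v (A x w y))
    (v : E) (hv : ‖v‖ < R) (y : ℝ → F)
    (hy : ∀ t ∈ Set.Icc (0:ℝ) 1,
      HasDerivWithinAt y (A (x₀ + t • v) v (y t)) (Set.Icc 0 1) t) :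
    ∃ K : ℝ, ∀ w : E, ‖v + w‖ < R → ∀ z : ℝ → F, z 0 = y 0 → (∀ t ∈ Set.Icc (0:ℝ) 1,
      HasDerivWithinAt z (A (x₀ + t • (v + w)) (v + w) (z t)) (Set.Icc 0 1) t) →
      ‖z 1 - y 1 - A (x₀ + v) w (y 1)‖ ≤ K * ‖w‖ ^ 2 := by
  have hmem : ∀ u : E, ‖u‖ < R → ∀ t ∈ Set.Icc (0:ℝ) 1, x₀ + t • u ∈ Metric.ball x₀ R := by
    intro u hu t ht
    rw [Metric.mem_ball, dist_eq_norm, add_sub_cancel_left, norm_smul, Real.norm_of_nonneg ht.1]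
    nlinarith [ht.2, norm_nonneg u]
  have hyc : ContinuousOn y (Set.Icc 0 1) := fun t ht => (hy t ht).continuousWithinAt
  obtain ⟨M, hM⟩ := isCompact_Icc.exists_bound_of_continuousOn hyc
  have hM0 : 0 ≤ M := (norm_nonneg _).trans (hM 0 (by simp))
  refine ⟨((2 * C + 4 * C ^ 2) * M) / C * (exp (C * 1) - 1), ?_⟩
  intro w hw z hz0 hz
  have hw2 : ‖w‖ ≤ 2 := by
    have := norm_sub_le (v + w) v
    rw [add_sub_cancel_left] at this
    linarith
  set ε := (2 * C + 4 * C ^ 2) * M * ‖w‖ ^ 2 with hε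
  let f : ℝ → F := fun t => y t + t • A (x₀ + t • v) w (y t)
  let f' : ℝ → F := fun t => A (x₀ + t • v) v (y t) + (A (x₀ + t • v) w (y t) +
    t • (A' (x₀ + t • v) v w (y t) + A (x₀ + t • v) w (A (x₀ + t • v) v (y t))))
  have hf : ∀ t ∈ Set.Icc (0:ℝ) 1, HasDerivWithinAt f (f' t) (Set.Icc 0 1) t := by
    intro t ht
    have h1 : HasDerivWithinAt (fun t : ℝ => A (x₀ + t • v)) (A' (x₀ + t • v) v) (Set.Icc 0 1) t := by
      have h2 : HasDerivAt (fun t : ℝ => x₀ + t • v) v t := by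
        simpa using ((hasDerivAt_id t).smul_const v).const_add x₀
      exact ((hd _ (hmem v hv t ht)).comp_hasDerivAt t h2).hasDerivWithinAt
    have h3 := (h1.clm_apply (hasDerivWithinAt_const t _ w)).clm_apply (hy t ht)
    have h4 := (hy t ht).add ((hasDerivWithinAt_id t (Set.Icc (0:ℝ) 1)).smul h3)
    convert! h4 using 1
    simp [f']
    abel
  have toIci : ∀ {g : ℝ → F} {g' : F} {t : ℝ}, t ∈ Set.Ico (0:ℝ) 1 →
      HasDerivWithinAt g g' (Set.Icc 0 1) t → HasDerivWithinAt g g' (Set.Ici t) t := by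
    intro g g' t ht h
    exact h.mono_of_mem_nhdsWithin (Icc_mem_nhdsGE_of_mem ht)
  let vf : ℝ → F → F := fun t u => A (x₀ + t • (v + w)) (v + w) u
  have key := dist_le_of_approx_trajectories_ODE_of_mem (v := vf) (s := fun _ => Set.univ)
    (K := C.toNNReal) (f := f) (f' := f') (g := z) (g' := fun t => vf t (z t)) (a := 0) (b := 1)
    (εf := ε) (εg := 0) (δ := 0) ?_ (fun t ht => (hf t ht).continuousWithinAt)
    (fun t ht => toIci ht (hf t ⟨ht.1, ht.2.le⟩)) ?_ (fun _ _ => trivial)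
    (fun t ht => (hz t ht).continuousWithinAt)
    (fun t ht => toIci ht (hz t ⟨ht.1, ht.2.le⟩)) (fun t ht => by simp) (fun _ _ => trivial)
    (by simp [f, hz0]) 1 (by simp)
  · have hC0 : C ≠ 0 := by linarith
    simp only [Real.coe_toNNReal C (by linarith), sub_zero, add_zero, gronwallBound_of_K_ne_0 hC0, zero_mul, zero_add] at key
    rw [dist_comm, dist_eq_norm] at key
    simp only [f, one_smul] at key
    rw [sub_sub]
    refine key.trans (le_of_eq ?_)
    rw [hε]
    ring
  · intro t ht
    have ht' : t ∈ Set.Icc (0:ℝ) 1 := ⟨ht.1, ht.2.le⟩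
    apply LipschitzWith.lipschitzOnWith
    apply (A (x₀ + t • (v + w)) (v + w)).lipschitz.weaken
    rw [← NNReal.coe_le_coe]
    simp only [coe_nnnorm, Real.coe_toNNReal C (by linarith)]
    calc _ ≤ ‖A (x₀ + t • (v + w))‖ * ‖v + w‖ := ContinuousLinearMap.le_opNorm _ _
      _ ≤ C * 1 := mul_le_mul (hA _ (hmem _ hw t ht')) (by linarith) (norm_nonneg _) (by linarith)
      _ = C := mul_one C
  · intro t ht
    have ht' : t ∈ Set.Icc (0:ℝ) 1 := ⟨ht.1, ht.2.le⟩
    have hx := hmem v hv t ht'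
    have hx' := hmem (v + w) hw t ht'
    have hT := frob_taylor A A' x₀ R C hd hL (by linarith) _ _ hx hx'
    have hPx := hA _ hx
    have hDx := hA' _ hx
    have hfl := hflat _ hx v w (y t)
    have hMt := hM t ht'
    have e1 : x₀ + t • (v + w) - (x₀ + t • v) = t • w := by rw [smul_add]; abel
    rw [e1] at hT
    simp only [vf, f, f']
    generalize x₀ + t • v = x at *
    generalize A (x₀ + t • (v + w)) = B at *
    generalize y t = u at *
    generalize A x = P at *
    generalize A' x = D at *
    obtain ⟨Q, hQ⟩ : ∃ Q, Q = B - P - D (t • w) := ⟨_, rfl⟩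
    rw [← hQ] at hT
    have hB : B = P + t • D w + Q := by rw [hQ, map_smul]; abel
    have hQn : ‖Q‖ ≤ C * ‖w‖ ^ 2 := by
      refine hT.trans ?_
      rw [norm_smul, Real.norm_of_nonneg ht.1]
      have : t * ‖w‖ ≤ ‖w‖ := by nlinarith [norm_nonneg w, ht.2]
      have := ht.1
      gcongr
    have e2 : P v u + (P w u + t • (D v w u + P w (P v u))) - B (v + w) (u + t • P w u)
       = - (t • (D w w u) + Q (v + w) u + t • P w (P w u) + (t * t) • D w (v + w) (P w u)
          + t • Q (v + w) (P w u)) := by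
      rw [hfl, hB]
      simp only [map_add, map_smul, _root_.add_apply, _root_.smul_apply, smul_add, smul_smul]
      abel
    rw [dist_eq_norm, e2, norm_neg]
    have hC0 : 0 ≤ C := by linarith
    have hvw : ‖v + w‖ ≤ 1 := by linarith
    have hw0 := norm_nonneg w
    have hs : ∀ (s : ℝ) (a : F), 0 ≤ s → s ≤ 1 → ‖s • a‖ ≤ ‖a‖ := by
      intro s a h0 h1
      rw [norm_smul, Real.norm_of_nonneg h0]
      nlinarith [norm_nonneg a]
    have hPw : ∀ a : F, ‖P w a‖ ≤ C * ‖w‖ * ‖a‖ := fun a =>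
      (P.le_opNorm₂ w a).trans (by gcongr)
    have hPwu : ‖P w u‖ ≤ C * ‖w‖ * M := (hPw u).trans (by gcongr)
    have hDw : ‖D w‖ ≤ C * ‖w‖ := (D.le_opNorm w).trans (by gcongr)
    have b1 : ‖t • (D w w u)‖ ≤ C * ‖w‖ * ‖w‖ * M :=
      (hs t _ ht.1 ht.2.le).trans (((D w).le_opNorm₂ w u).trans (by gcongr))
    have b2 : ‖Q (v + w) u‖ ≤ C * ‖w‖ ^ 2 * 1 * M :=
      (Q.le_opNorm₂ _ u).trans (by gcongr)
    have b3 : ‖t • P w (P w u)‖ ≤ C * ‖w‖ * (C * ‖w‖ * M) :=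
      (hs t _ ht.1 ht.2.le).trans ((hPw _).trans (by gcongr))
    have b4 : ‖(t * t) • D w (v + w) (P w u)‖ ≤ C * ‖w‖ * 1 * (C * ‖w‖ * M) :=
      (hs _ _ (mul_nonneg ht.1 ht.1) (by nlinarith [ht.1, ht.2])).trans
        (((D w).le_opNorm₂ _ _).trans (by gcongr))
    have b5 : ‖t • Q (v + w) (P w u)‖ ≤ C * ‖w‖ ^ 2 * 1 * (C * 2 * M) :=
      (hs t _ ht.1 ht.2.le).trans ((Q.le_opNorm₂ _ _).trans (by
        have : ‖P w u‖ ≤ C * 2 * M := hPwu.trans (by gcongr)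
        gcongr))
    refine (norm_add_le_of_le (norm_add_le_of_le (norm_add_le_of_le (norm_add_le_of_le b1 b2) b3) b4) b5).trans
      (le_of_eq ?_)
    rw [hε]
    ring

lemma frob_exists [CompleteSpace F] (A : E → E →L[ℝ] F →L[ℝ] F) (U : Set E) (hU : IsOpen U)
    (hA : ContDiffOn ℝ (⊤ : ℕ∞) A U)
    (hflat : ∀ x ∈ U, ∀ v w y, fderiv ℝ A x v w y + A x w (A x v y)
      = fderiv ℝ A x w v y + A x v (A x w y)) (x₀ : E) (hx₀ : x₀ ∈ U) :
    ∃ R > 0, Metric.ball x₀ R ⊆ U ∧ ∀ y₀ : F, ∃ Y : E → F, Y x₀ = y₀ ∧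
      (∀ x ∈ Metric.ball x₀ R, HasFDerivAt Y ((A x).flip (Y x)) x) ∧
      ContDiffOn ℝ (⊤ : ℕ∞) Y (Metric.ball x₀ R) := by
  have hA1 := (contDiffOn_infty_iff_fderiv_of_isOpen hU).1 hA
  have hUn := hU.mem_nhds hx₀
  obtain ⟨K, s, hs, hK⟩ := (((hA1.2.contDiffAt hUn).of_le (by simp)) : ContDiffAt ℝ 1 _ x₀).exists_lipschitzOnWith
  have hc1 : ∀ᶠ x in nhds x₀, ‖A x‖ < ‖A x₀‖ + 1 :=
    (hA.continuousOn.continuousAt hUn).norm.eventually_lt_const (by linarith)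
  have hc2 : ∀ᶠ x in nhds x₀, ‖fderiv ℝ A x‖ < ‖fderiv ℝ A x₀‖ + 1 :=
    (hA1.2.continuousOn.continuousAt hUn).norm.eventually_lt_const (by linarith)
  obtain ⟨R₁, hR₁, hR₁'⟩ := Metric.eventually_nhds_iff_ball.1 ((hc1.and hc2).and ((Filter.eventually_mem_set.2 hs).and (Filter.eventually_mem_set.2 hUn)))
  set C : ℝ := (‖A x₀‖ + 1) + (‖fderiv ℝ A x₀‖ + 1) + K with hC
  have hC1 : 1 ≤ C := by
    have := norm_nonneg (A x₀); have := norm_nonneg (fderiv ℝ A x₀); have := K.2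
    have : (0:ℝ) ≤ K := K.2
    linarith
  have n1 := norm_nonneg (A x₀)
  have n2 := norm_nonneg (fderiv ℝ A x₀)
  have n3 : (0:ℝ) ≤ K := K.2
  set R := min R₁ (1 / (2 * C)) with hR
  have hRpos : 0 < R := by positivity
  have hRC : R * C ≤ 1 / 2 := by
    have : R ≤ 1 / (2 * C) := min_le_right _ _
    calc R * C ≤ 1 / (2 * C) * C := by gcongr
      _ = 1 / 2 := by field_simp
  have hR1 : R ≤ 1 := by nlinarith
  have hball : Metric.ball x₀ R ⊆ Metric.ball x₀ R₁ := Metric.ball_subset_ball (min_le_left _ _)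
  have hRU : Metric.ball x₀ R ⊆ U := fun x hx => (hR₁' x (hball hx)).2.2
  have gA : ∀ x ∈ Metric.ball x₀ R, ‖A x‖ ≤ C := fun x hx => by
    have := (hR₁' x (hball hx)).1.1
    linarith
  have gA' : ∀ x ∈ Metric.ball x₀ R, ‖fderiv ℝ A x‖ ≤ C := fun x hx => by
    have := (hR₁' x (hball hx)).1.2
    linarith
  have gd : ∀ x ∈ Metric.ball x₀ R, HasFDerivAt A (fderiv ℝ A x) x := fun x hx =>
    (hA1.1.differentiableAt (hU.mem_nhds (hRU hx))).hasFDerivAt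
  have gL : ∀ x ∈ Metric.ball x₀ R, ∀ y ∈ Metric.ball x₀ R,
      ‖fderiv ℝ A x - fderiv ℝ A y‖ ≤ C * ‖x - y‖ := by
    intro x hx y hy
    refine (hK.norm_sub_le (hR₁' x (hball hx)).2.1 (hR₁' y (hball hy)).2.1).trans ?_
    gcongr
    linarith
  refine ⟨R, hRpos, hRU, fun y₀ => ?_⟩
  have hray := fun v hv => frob_ray A x₀ R C (by linarith) hRC (hA.continuousOn.mono hRU) gA y₀ v hv
  choose! y hy0 hy using hray
  let Y : E → F := fun x => y (x - x₀) 1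
  have hYd : ∀ x ∈ Metric.ball x₀ R, HasFDerivAt Y ((A x).flip (Y x)) x := by
    intro x hx
    have hx' : ‖x - x₀‖ < R := by rwa [Metric.mem_ball, dist_eq_norm] at hx
    obtain ⟨K, hK⟩ := frob_est A (fderiv ℝ A) x₀ R C hC1 hR1 gd gA gA' gL
      (fun x hx => hflat x (hRU hx)) (x - x₀) hx' (y (x - x₀)) (hy _ hx')
    rw [hasFDerivAt_iff_isLittleO_nhds_zero]
    have hO : (fun w : E => Y (x + w) - Y x - (A x).flip (Y x) w) =O[nhds 0] (fun w : E => ‖w‖ ^ 2) := by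
      apply Asymptotics.IsBigO.of_bound K
      have : ∀ᶠ w in nhds (0:E), x + w ∈ Metric.ball x₀ R :=
        (Continuous.tendsto' (by fun_prop) _ _ (add_zero x) : Filter.Tendsto (fun w => x + w) (nhds 0) (nhds x)).eventually_mem
          (Metric.isOpen_ball.mem_nhds hx)
      filter_upwards [this] with w hw
      have hw' : ‖x - x₀ + w‖ < R := by
        rw [Metric.mem_ball, dist_eq_norm] at hw
        have e : x - x₀ + w = x + w - x₀ := by abel
        rwa [e]
      have := hK w hw' (y (x - x₀ + w)) (by rw [hy0 _ hw', hy0 _ hx']) (hy _ hw')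
      rw [add_sub_cancel] at this
      have e : x + w - x₀ = x - x₀ + w := by abel
      simpa [Y, e] using this
    refine hO.trans_isLittleO ?_
    simpa using! Asymptotics.isLittleO_norm_pow_id one_lt_two
  refine ⟨Y, ?_, hYd, ?_⟩
  · have h0 : ‖(0:E)‖ < R := by simpa
    have h1 := hy 0 h0
    simp only [map_zero, _root_.zero_apply] at h1
    have := constant_of_has_deriv_right_zero (f := y 0) (a := 0) (b := 1) (fun t ht => (h1 t ht).continuousWithinAt)
      (fun t ht => (h1 t ⟨ht.1, ht.2.le⟩).mono_of_mem_nhdsWithin (Icc_mem_nhdsGE_of_mem ht)) 1 (by simp)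
    simp [Y, this, hy0 0 h0]
  · have hfl : ContDiffOn ℝ (⊤ : ℕ∞) (fun x => (A x).flip) (Metric.ball x₀ R) :=
      (ContinuousLinearMap.flipₗᵢ ℝ E F F).toContinuousLinearEquiv.contDiff.comp_contDiffOn (hA.mono hRU)
    rw [contDiffOn_infty]
    intro k
    induction k with
    | zero => exact contDiffOn_zero.2 fun x hx => (hYd x hx).continuousAt.continuousWithinAt
    | succ k ih =>
      push_cast
      rw [contDiffOn_succ_iff_fderiv_of_isOpen Metric.isOpen_ball]
      refine ⟨fun x hx => (hYd x hx).differentiableAt.differentiableWithinAt, by simp, ?_⟩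
      refine ContDiffOn.congr (f := fun x => (A x).flip (Y x)) ?_ (fun x hx => (hYd x hx).fderiv)
      exact (hfl.of_le (by exact_mod_cast le_top)).clm_apply ih
end frob

section uniq
variable {E F : Type*} [NormedAddCommGroup E] [NormedSpace ℝ E]
  [NormedAddCommGroup F] [NormedSpace ℝ F]

lemma lin_uniq (A : E → E →L[ℝ] F →L[ℝ] F) (W : Set E) (hW : IsOpen W) (hWc : IsPreconnected W)
    (hA : ContinuousOn A W) (D : E → F) (hD : ∀ x ∈ W, HasFDerivAt D ((A x).flip (D x)) x)
    (x₀ : E) (hx₀ : x₀ ∈ W) (h0 : D x₀ = 0) : ∀ x ∈ W, D x = 0 := by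
  have hsub : W ⊆ {x | x ∈ W ∧ D x = 0} := by
    apply hWc.subset_of_closure_inter_subset
    · rw [isOpen_iff_mem_nhds]
      rintro x₁ ⟨hx₁, hD₁⟩
      have hc1 : ∀ᶠ x in nhds x₁, ‖A x‖ < ‖A x₁‖ + 1 :=
        (hA.continuousAt (hW.mem_nhds hx₁)).norm.eventually_lt_const (by linarith)
      obtain ⟨R, hR, hR'⟩ := Metric.eventually_nhds_iff_ball.1
        (hc1.and (Filter.eventually_mem_set.2 (hW.mem_nhds hx₁)))
      refine Filter.mem_of_superset (Metric.ball_mem_nhds x₁ hR) ?_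
      intro x hx
      refine ⟨(hR' x hx).2, ?_⟩
      have hmem : ∀ t ∈ Set.Icc (0:ℝ) 1, x₁ + t • (x - x₁) ∈ Metric.ball x₁ R := by
        intro t ht
        rw [Metric.mem_ball, dist_eq_norm] at hx
        rw [Metric.mem_ball, dist_eq_norm, add_sub_cancel_left, norm_smul, Real.norm_of_nonneg ht.1]
        nlinarith [ht.2, norm_nonneg (x - x₁)]
      have hd : ∀ t ∈ Set.Icc (0:ℝ) 1, HasDerivAt (fun t : ℝ => D (x₁ + t • (x - x₁)))
          (A (x₁ + t • (x - x₁)) (x - x₁) (D (x₁ + t • (x - x₁)))) t := by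
        intro t ht
        have h2 : HasDerivAt (fun t : ℝ => x₁ + t • (x - x₁)) (x - x₁) t := by
          simpa using ((hasDerivAt_id t).smul_const (x - x₁)).const_add x₁
        exact (hD _ (hR' _ (hmem t ht)).2).comp_hasDerivAt t h2
      have := eq_zero_of_abs_deriv_le_mul_abs_self_of_eq_zero_right (a := 0) (b := 1)
        (K := (‖A x₁‖ + 1) * ‖x - x₁‖)
        (fun t ht => (hd t ht).continuousAt.continuousWithinAt)
        (fun t ht => (hd t ⟨ht.1, ht.2.le⟩).hasDerivWithinAt) (by simpa using hD₁)
        (fun t ht => by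
          refine ((A _).le_opNorm₂ _ _).trans ?_
          have := (hR' _ (hmem t ⟨ht.1, ht.2.le⟩)).1
          gcongr) 1 (by simp)
      simpa using this
    · exact ⟨x₀, hx₀, hx₀, h0⟩
    · rintro x ⟨hxc, hx⟩
      refine ⟨hx, ?_⟩
      rw [mem_closure_iff_frequently] at hxc
      have hcl : ∃ᶠ y in nhds x, D y ∈ ({0} : Set F) := hxc.mono fun y hy => hy.2
      have := isClosed_singleton.mem_of_frequently_of_tendsto hcl (hD x hx).continuousAt
      simpa using this
  exact fun x hx => (hsub hx).2
end uniq

section coord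
variable {n : ℕ} {N : Type*} [Fintype N] [DecidableEq N]

noncomputable def coordA (M : Fin n → N → N → ℝ) : (Fin n → ℝ) →L[ℝ] (N → ℝ) →L[ℝ] (N → ℝ) :=
  ∑ m, ∑ i, ∑ j, M m i j • (ContinuousLinearMap.proj (R := ℝ) (φ := fun _ : Fin n => ℝ) m).smulRight
    ((ContinuousLinearMap.proj (R := ℝ) (φ := fun _ : N => ℝ) j).smulRight (Pi.single i (1:ℝ) : N → ℝ))

lemma coordA_apply (M : Fin n → N → N → ℝ) (w : Fin n → ℝ) (y : N → ℝ) (i : N) :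
    coordA M w y i = ∑ m, ∑ j, w m * (M m i j * y j) := by
  simp only [coordA, _root_.sum_apply, _root_.smul_apply, ContinuousLinearMap.smulRight_apply, ContinuousLinearMap.proj_apply,
    Finset.sum_apply, Pi.smul_apply, Pi.single_apply, smul_eq_mul]
  refine Finset.sum_congr rfl fun m _ => ?_
  rw [Finset.sum_comm]
  refine Finset.sum_congr rfl fun j _ => ?_
  simp
  ring

lemma coordA_contDiffOn (M : (Fin n → ℝ) → Fin n → N → N → ℝ) (U : Set (Fin n → ℝ))
    (hM : ∀ m i j, ContDiffOn ℝ (⊤ : ℕ∞) (fun x => M x m i j) U) :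
    ContDiffOn ℝ (⊤ : ℕ∞) (fun x => coordA (M x)) U := by
  unfold coordA
  exact ContDiffOn.sum fun m _ => ContDiffOn.sum fun i _ => ContDiffOn.sum fun j _ =>
    (hM m i j).smul contDiffOn_const

lemma coordA_continuousOn (M : (Fin n → ℝ) → Fin n → N → N → ℝ) (U : Set (Fin n → ℝ))
    (hM : ∀ m i j, ContinuousOn (fun x => M x m i j) U) :
    ContinuousOn (fun x => coordA (M x)) U := by
  unfold coordA
  exact continuousOn_finsetSum _ fun m _ => continuousOn_finsetSum _ fun i _ => continuousOn_finsetSum _ fun j _ =>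
    (hM m i j).smul continuousOn_const

lemma coordA_hasFDerivAt (M : (Fin n → ℝ) → Fin n → N → N → ℝ) (x : Fin n → ℝ)
    (hM : ∀ m i j, DifferentiableAt ℝ (fun x => M x m i j) x) (v : Fin n → ℝ) :
    fderiv ℝ (fun x => coordA (M x)) x v =
      coordA (fun m i j => fderiv ℝ (fun x => M x m i j) x v) := by
  have : HasFDerivAt (fun x => coordA (M x)) (∑ m, ∑ i, ∑ j, (fderiv ℝ (fun x => M x m i j) x).smulRight ((ContinuousLinearMap.proj (R := ℝ) (φ := fun _ : Fin n => ℝ) m).smulRight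
    ((ContinuousLinearMap.proj (R := ℝ) (φ := fun _ : N => ℝ) j).smulRight (Pi.single i (1:ℝ) : N → ℝ)))) x := by
    unfold coordA
    exact HasFDerivAt.fun_sum fun m _ => HasFDerivAt.fun_sum fun i _ => HasFDerivAt.fun_sum fun j _ =>
      (hM m i j).hasFDerivAt.smul_const _
  rw [this.fderiv]
  simp only [coordA, _root_.sum_apply, ContinuousLinearMap.smulRight_apply]

lemma fderiv_eq_sum_pd (f : (Fin n → ℝ) → ℝ) (x v : Fin n → ℝ) :
    fderiv ℝ f x v = ∑ a, v a * pd a f x := by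
  conv_lhs => rw [← Finset.univ_sum_single v]
  rw [map_sum]
  refine Finset.sum_congr rfl fun a _ => ?_
  rw [pd, ← smul_eq_mul, ← map_smul]
  congr 1
  rw [← Pi.single_smul]
  simp

lemma frob_coord (M : (Fin n → ℝ) → Fin n → N → N → ℝ) (U : Set (Fin n → ℝ)) (hU : IsOpen U)
    (hM : ∀ m i j, ContDiffOn ℝ (⊤ : ℕ∞) (fun x => M x m i j) U)
    (hflat : ∀ x ∈ U, ∀ a b i k, pd a (fun y => M y b i k) x + ∑ j, M x b i j * M x a j k =
      pd b (fun y => M y a i k) x + ∑ j, M x a i j * M x b j k)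
    (x₀ : Fin n → ℝ) (hx₀ : x₀ ∈ U) :
    ∃ R > 0, Metric.ball x₀ R ⊆ U ∧ ∀ y₀ : N → ℝ, ∃ Y : (Fin n → ℝ) → N → ℝ, Y x₀ = y₀ ∧
      (∀ i, ContDiffOn ℝ (⊤ : ℕ∞) (fun x => Y x i) (Metric.ball x₀ R)) ∧
      ∀ x ∈ Metric.ball x₀ R, ∀ m i, pd m (fun y => Y y i) x = ∑ j, M x m i j * Y x j := by
  have key : ∀ x ∈ U, ∀ (v w : Fin n → ℝ) (y : N → ℝ) (i : N),
      (fderiv ℝ (fun x => coordA (M x)) x v w y + coordA (M x) w (coordA (M x) v y)) i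
      = ∑ b, ∑ a, ∑ k, w b * v a * y k *
        (pd a (fun y => M y b i k) x + ∑ j, M x b i j * M x a j k) := by
    intro x hx v w y i
    rw [coordA_hasFDerivAt M x (fun m i j => ((hM m i j).contDiffAt (hU.mem_nhds hx)).differentiableAt (by simp)),
      Pi.add_apply, coordA_apply, coordA_apply, ← Finset.sum_add_distrib]
    refine Finset.sum_congr rfl fun b _ => ?_
    simp only [mul_add, Finset.sum_add_distrib, coordA_apply, fderiv_eq_sum_pd, Finset.sum_mul, Finset.mul_sum]
    congr 1
    · rw [Finset.sum_comm]
      exact Finset.sum_congr rfl fun a _ => Finset.sum_congr rfl fun k _ => by ring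
    · rw [Finset.sum_comm]
      refine Finset.sum_congr rfl fun a _ => ?_
      rw [Finset.sum_comm]
      exact Finset.sum_congr rfl fun k _ => Finset.sum_congr rfl fun j _ => by ring
  obtain ⟨R, hR, hRU, H⟩ := frob_exists (fun x => coordA (M x)) U hU (coordA_contDiffOn M U hM)
    (by
      intro x hx v w y
      ext i
      rw [key x hx v w y i, key x hx w v y i, Finset.sum_comm]
      refine Finset.sum_congr rfl fun b _ => Finset.sum_congr rfl fun a _ =>
        Finset.sum_congr rfl fun k _ => ?_
      rw [hflat x hx b a i k]
      ring) x₀ hx₀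
  refine ⟨R, hR, hRU, fun y₀ => ?_⟩
  obtain ⟨Y, hY0, hYd, hYs⟩ := H y₀
  refine ⟨Y, hY0, fun i => contDiffOn_pi.1 hYs i, fun x hx m i => ?_⟩
  have := (hasFDerivAt_pi'.1 (hYd x hx) i).fderiv
  rw [pd, this]
  simp [coordA_apply, Pi.single_apply]

lemma coord_uniq (M : (Fin n → ℝ) → Fin n → N → N → ℝ) (W : Set (Fin n → ℝ)) (hW : IsOpen W)
    (hWc : IsPreconnected W) (hM : ∀ m i j, ContinuousOn (fun x => M x m i j) W)
    (D : (Fin n → ℝ) → N → ℝ) (hD : ∀ x ∈ W, ∀ i, DifferentiableAt ℝ (fun x => D x i) x)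
    (hD' : ∀ x ∈ W, ∀ m i, pd m (fun y => D y i) x = ∑ j, M x m i j * D x j)
    (x₀ : Fin n → ℝ) (hx₀ : x₀ ∈ W) (h0 : D x₀ = 0) : ∀ x ∈ W, D x = 0 := by
  refine lin_uniq (fun x => coordA (M x)) W hW hWc (coordA_continuousOn M W hM) D ?_ x₀ hx₀ h0
  intro x hx
  rw [hasFDerivAt_pi']
  intro i
  refine (hD x hx i).hasFDerivAt.congr_fderiv ?_
  ext1 v
  rw [fderiv_eq_sum_pd]
  simp only [hD' x hx, ContinuousLinearMap.comp_apply, ContinuousLinearMap.proj_apply, ContinuousLinearMap.flip_apply, coordA_apply, Finset.mul_sum]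
end coord

set_option linter.unusedSimpArgs false

section geom
variable {n : ℕ}

lemma bIG_contDiffOn (h : (Fin n → ℝ) → Fin n → Fin n → ℝ) (U : Set (Fin n → ℝ))
    (hh : ∀ i j, ContDiffOn ℝ (⊤ : ℕ∞) (fun x => h x i j) U) (k l m : Fin n) :
    ContDiffOn ℝ (⊤ : ℕ∞) (fun x => bIG h x k l m) U := by
  unfold bIG
  split_ifs
  · exact contDiffOn_const
  · exact (hh _ _).sub (hh _ _)
  · exact (hh _ _).sub contDiffOn_const
  · exact contDiffOn_const.sub (hh _ _)
  · exact contDiffOn_const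

lemma bIG_anti (h : (Fin n → ℝ) → Fin n → Fin n → ℝ) (x : Fin n → ℝ) (k l m : Fin n) :
    bIG h x k l m = - bIG h x l k m := by
  unfold bIG
  by_cases hkl : k = l
  · simp [hkl]
  · rw [if_neg hkl, if_neg (Ne.symm hkl)]; ring

/-- the zero-diagonal version of `h` -/
def gIG (h : (Fin n → ℝ) → Fin n → Fin n → ℝ) (x : Fin n → ℝ) (k l : Fin n) : ℝ :=
  if k = l then 0 else h x k l

lemma bIG_eq (h : (Fin n → ℝ) → Fin n → Fin n → ℝ) (x : Fin n → ℝ) (k l m : Fin n) :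
    bIG h x k l m = (if l = m then gIG h x k l else 0) - (if k = m then gIG h x l k else 0) := by
  unfold bIG gIG
  by_cases hkl : k = l
  · simp [hkl]
  · simp [hkl, Ne.symm hkl]

/-- the linear system -/
def MIG (V : (Fin n → ℝ) → Fin n → ℝ) (h : (Fin n → ℝ) → Fin n → Fin n → ℝ)
    (x : Fin n → ℝ) (m : Fin n) : Option (Fin n) → Option (Fin n) → ℝ
  | some l, some k => - bIG h x k l m
  | some l, none => if l = m then - V x m else 0
  | none, some k => if k = m then - V x m else 0
  | none, none => 0

lemma MIG_contDiffOn (V : (Fin n → ℝ) → Fin n → ℝ) (h : (Fin n → ℝ) → Fin n → Fin n → ℝ)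
    (U : Set (Fin n → ℝ)) (hV : ∀ i, ContDiffOn ℝ (⊤ : ℕ∞) (fun x => V x i) U)
    (hh : ∀ i j, ContDiffOn ℝ (⊤ : ℕ∞) (fun x => h x i j) U) (m : Fin n) (i j : Option (Fin n)) :
    ContDiffOn ℝ (⊤ : ℕ∞) (fun x => MIG V h x m i j) U := by
  rcases i with _ | l <;> rcases j with _ | k <;> simp only [MIG]
  · exact contDiffOn_const
  · split_ifs
    · exact (hV _).neg
    · exact contDiffOn_const
  · split_ifs
    · exact (hV _).neg
    · exact contDiffOn_const
  · exact (bIG_contDiffOn h U hh _ _ _).neg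

lemma pd_neg (m : Fin n) (f : (Fin n → ℝ) → ℝ) (x : Fin n → ℝ) :
    pd m (fun y => - f y) x = - pd m f x := by
  simp [pd, fderiv_fun_neg]

lemma pd_const (m : Fin n) (c : ℝ) (x : Fin n → ℝ) : pd m (fun _ => c) x = 0 := by
  simp [pd]

lemma pd_ite (m : Fin n) (p : Prop) [Decidable p] (f g : (Fin n → ℝ) → ℝ) (x : Fin n → ℝ) :
    pd m (fun y => if p then f y else g y) x = if p then pd m f x else pd m g x := by
  split_ifs <;> rfl

lemma pd_sub (m : Fin n) (f g : (Fin n → ℝ) → ℝ) (x : Fin n → ℝ) (hf : DifferentiableAt ℝ f x)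
    (hg : DifferentiableAt ℝ g x) :
    pd m (fun y => f y - g y) x = pd m f x - pd m g x := by
  simp [pd, fderiv_fun_sub hf hg]

lemma pd_mul (m : Fin n) (f g : (Fin n → ℝ) → ℝ) (x : Fin n → ℝ) (hf : DifferentiableAt ℝ f x)
    (hg : DifferentiableAt ℝ g x) :
    pd m (fun y => f y * g y) x = pd m f x * g x + f x * pd m g x := by
  simp [pd, fderiv_fun_mul hf hg]
  ring

lemma pd_sum {ι : Type*} (s : Finset ι) (m : Fin n) (f : ι → (Fin n → ℝ) → ℝ) (x : Fin n → ℝ)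
    (hf : ∀ i ∈ s, DifferentiableAt ℝ (f i) x) :
    pd m (fun y => ∑ i ∈ s, f i y) x = ∑ i ∈ s, pd m (f i) x := by
  simp [pd, fderiv_fun_sum hf]

lemma pd_bIG (h : (Fin n → ℝ) → Fin n → Fin n → ℝ) (x : Fin n → ℝ)
    (hd : ∀ i j, DifferentiableAt ℝ (fun y => h y i j) x) (a k l m : Fin n) :
    pd a (fun y => bIG h y k l m) x = (if l = m then pd a (fun y => gIG h y k l) x else 0)
      - (if k = m then pd a (fun y => gIG h y l k) x else 0) := by
  have hg : ∀ i j, DifferentiableAt ℝ (fun y => gIG h y i j) x := by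
    intro i j
    unfold gIG
    split_ifs
    · exact differentiableAt_const _
    · exact hd i j
  simp only [bIG_eq]
  rw [pd_sub]
  · simp only [pd_ite, pd_const]
  · split_ifs
    · exact hg _ _
    · exact differentiableAt_const _
  · split_ifs
    · exact hg _ _
    · exact differentiableAt_const _

lemma MIG_flat (V : (Fin n → ℝ) → Fin n → ℝ) (h : (Fin n → ℝ) → Fin n → Fin n → ℝ)
    (U : Set (Fin n → ℝ)) (hU : IsOpen U)
    (hh : ∀ i j, ContDiffOn ℝ (⊤ : ℕ∞) (fun x => h x i j) U)
    (hsol : IGSGE n U V h) (x : Fin n → ℝ) (hx : x ∈ U) (a b : Fin n) (i k : Option (Fin n)) :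
    pd a (fun y => MIG V h y b i k) x + ∑ j, MIG V h x b i j * MIG V h x a j k =
      pd b (fun y => MIG V h y a i k) x + ∑ j, MIG V h x a i j * MIG V h x b j k := by
  by_cases hab : a = b
  · subst hab; rfl
  have hba : b ≠ a := Ne.symm hab
  obtain ⟨-, h1, h2, h3⟩ := hsol x hx
  have hd : ∀ i j, DifferentiableAt ℝ (fun y => h y i j) x := fun i j =>
    ((hh i j).contDiffAt (hU.mem_nhds hx)).differentiableAt (by simp)
  have v1 := h1 b a hba
  have v2 := h1 a b hab
  rcases i with _ | l <;> rcases k with _ | k <;> rw [Fintype.sum_option, Fintype.sum_option] <;>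
    simp only [MIG]
  · simp [pd_const, hab, hba]
  · simp only [ite_mul, mul_ite, zero_mul, mul_zero, Finset.sum_ite_eq', Finset.mem_univ, if_true]
    simp only [pd_ite, pd_const, pd_neg, v1, v2, bIG]
    by_cases hka : k = a
    · subst hka; simp [hab, hba]
    · by_cases hkb : k = b
      · subst hkb; simp [hab, hba]
      · simp [hka, hkb, hab, hba]
  · simp only [ite_mul, mul_ite, zero_mul, mul_zero, Finset.sum_ite_eq', Finset.mem_univ, if_true]
    simp only [pd_ite, pd_const, pd_neg, v1, v2, bIG]
    by_cases hka : l = a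
    · subst hka; simp [hab, hba]; ring
    · by_cases hkb : l = b
      · subst hkb; simp [hab, hba]; ring
      · simp [hka, hkb, hab, hba]
  · have gself : ∀ y s, gIG h y s s = 0 := fun y s => by simp [gIG]
    have gne : ∀ y s t, s ≠ t → gIG h y s t = h y s t := fun y s t hst => by simp [gIG, hst]
    have S : ∀ a b : Fin n, a ≠ b → ∑ s ∈ Finset.univ.filter (fun s => s ≠ a ∧ s ≠ b), h x s a * h x s b
        = ∑ s, gIG h x s a * gIG h x s b := by
      intro a b hab
      rw [Finset.sum_filter]
      refine Finset.sum_congr rfl fun s _ => ?_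
      by_cases hsa : s = a
      · simp [hsa, gself]
      · by_cases hsb : s = b
        · simp [hsb, gself]
        · simp [hsa, hsb, gne]
    have G2 : pd a (fun y => gIG h y a b) x + pd b (fun y => gIG h y b a) x
        + ∑ s, gIG h x s a * gIG h x s b = V x a * V x b := by
      rw [← S a b hab, ← h2 a b hab]
      simp only [gne _ _ _ hab, gne _ _ _ hba]
    have G3 : ∀ s t k : Fin n, k ≠ s → k ≠ t → s ≠ t →
        pd s (fun y => gIG h y k t) x = gIG h x k s * gIG h x s t := by
      intro s t k hks hkt hst
      simp only [gne _ _ _ hks, gne _ _ _ hkt, gne _ _ _ hst]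
      exact h3 k t s hkt hks (Ne.symm hst)
    have G0 : ∀ s t, pd s (fun y => gIG h y t t) x = 0 := by
      intro s t
      simp only [gself, pd_const]
    have P : ∀ a b : Fin n, a ≠ b → ∑ s, -bIG h x s l b * -bIG h x k s a =
        (if l = b then gIG h x k a * gIG h x a b else 0)
        - (if l = b ∧ k = a then ∑ s, gIG h x s a * gIG h x s b else 0)
        + (if k = a then gIG h x l b * gIG h x b a else 0) := by
      intro a b hab
      have : ∀ s, -bIG h x s l b * -bIG h x k s a =
          (if s = a then (if l = b then gIG h x k a * gIG h x a b else 0) else 0)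
          - (if l = b ∧ k = a then gIG h x s a * gIG h x s b else 0)
          + (if s = b then (if k = a then gIG h x l b * gIG h x b a else 0) else 0) := by
        intro s
        rw [bIG_eq, bIG_eq]
        by_cases c1 : l = b <;> by_cases c2 : k = a <;> by_cases c3 : s = a <;> by_cases c4 : s = b <;>
          first
          | (exfalso; exact hab (c3.symm.trans c4))
          | (simp [c1, c2, c3, c4, hab, Ne.symm hab] <;> ring)
      simp only [this, Finset.sum_add_distrib, Finset.sum_sub_distrib, Finset.sum_ite_eq',
        Finset.mem_univ, if_true]
      congr 2
      by_cases c : l = b ∧ k = a <;> simp [c]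
    have S' : ∑ s, gIG h x s b * gIG h x s a = ∑ s, gIG h x s a * gIG h x s b :=
      Finset.sum_congr rfl fun s _ => mul_comm _ _
    rw [P a b hab, P b a hba, S', pd_neg, pd_neg, pd_bIG h x hd, pd_bIG h x hd]
    generalize (∑ s, gIG h x s a * gIG h x s b) = Sig at *
    by_cases la : l = a
    · subst la
      by_cases ka : k = l
      · subst ka
        simp [hab, gself, G0]
      · by_cases kb : k = b
        · subst kb
          simp [hab, hba, gself, G0]
          linarith
        · simp [hab, hba, ka, kb, gself, G0, G3 b l k kb ka hba]
    · by_cases lb : l = b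
      · subst lb
        by_cases ka : k = a
        · subst ka
          simp [hab, hba, gself, G0]
          linarith
        · by_cases kb : k = l
          · subst kb
            simp [hab, hba, gself, G0]
          · simp [hab, hba, ka, kb, gself, G0, G3 a l k ka kb hab]
      · by_cases ka : k = a
        · subst ka
          simp [hab, hba, la, lb, G3 b k l lb la hba]
        · by_cases kb : k = b
          · subst kb
            simp [hba, la, lb, G3 a k l la lb hab]
          · simp [la, lb, ka, kb]
end geom

section frame
variable {n : ℕ} [NeZero n]

lemma diff_div (f g : (Fin n → ℝ) → ℝ) (x : Fin n → ℝ) (hf : DifferentiableAt ℝ f x)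
    (hg : DifferentiableAt ℝ g x) (h0 : g x ≠ 0) :
    DifferentiableAt ℝ (fun y => f y / g y) x := by
  simp only [div_eq_mul_inv]
  exact hf.fun_mul (hg.fun_inv h0)

lemma pd_div (m : Fin n) (f g : (Fin n → ℝ) → ℝ) (x : Fin n → ℝ) (hf : DifferentiableAt ℝ f x)
    (hg : DifferentiableAt ℝ g x) (h0 : g x ≠ 0) :
    pd m (fun y => f y / g y) x = (pd m f x * g x - f x * pd m g x) / g x ^ 2 := by
  have h1 := pd_mul m (fun y => f y / g y) g x (diff_div f g x hf hg h0) hg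
  have h2 : pd m (fun y => f y / g y * g y) x = pd m f x := by
    unfold pd
    congr 1
    apply Filter.EventuallyEq.fderiv_eq
    filter_upwards [hg.continuousAt.eventually_ne h0] with y hy
    field_simp
  rw [h2] at h1
  field_simp at h1 ⊢
  linarith

/-- the equivalent first-order system in normal form -/
def FrameODE (V : (Fin n → ℝ) → Fin n → ℝ) (h : (Fin n → ℝ) → Fin n → Fin n → ℝ)
    (L : (Fin n → ℝ) → Matrix (Fin n) (Fin n) ℝ) (x : Fin n → ℝ) : Prop :=
  ∀ m i k, pd m (fun y => L y i k) x = - (∑ s, L x i s * bIG h x s k m)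
    - (if i = 0 then (if k = m then V x m else 0) else 0) + L x i m * V x m * L x 0 k

lemma FrameODE.sum_eq {V : (Fin n → ℝ) → Fin n → ℝ} {h : (Fin n → ℝ) → Fin n → Fin n → ℝ}
    {L : (Fin n → ℝ) → Matrix (Fin n) (Fin n) ℝ} {x : Fin n → ℝ} (H : FrameODE V h L x)
    (hL : L x * (L x)ᵀ = 1) (m i j : Fin n) (hj : j ≠ 0) :
    (∑ k, pd m (fun y => L y i k) x * L x j k)
      + (∑ k, ∑ l, L x i k * bIG h x k l m * L x j l)
      = - (if i = 0 then L x j m * V x m else 0) := by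
  have h0 : ∑ k, L x 0 k * L x j k = 0 := by
    have := congrFun (congrFun hL 0) j
    rw [Matrix.mul_apply, Matrix.one_apply_ne (Ne.symm hj)] at this
    simpa using this
  have e : ∀ k, pd m (fun y => L y i k) x * L x j k = - (∑ s, L x i s * bIG h x s k m * L x j k)
      - (if k = m then (if i = 0 then L x j m * V x m else 0) else 0)
      + L x i m * V x m * (L x 0 k * L x j k) := by
    intro k
    rw [H m i k, ← Finset.sum_mul]
    by_cases c : k = m
    · subst c; split_ifs <;> ring
    · simp only [c, if_false]; split_ifs <;> ring
  simp only [e]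
  rw [Finset.sum_add_distrib, Finset.sum_sub_distrib, ← Finset.mul_sum, h0, Finset.sum_neg_distrib,
    Finset.sum_comm]
  simp only [Finset.sum_ite_eq', Finset.mem_univ, if_true]
  ring

lemma frameODE_of_sol (V : (Fin n → ℝ) → Fin n → ℝ) (h : (Fin n → ℝ) → Fin n → Fin n → ℝ)
    (L : (Fin n → ℝ) → Matrix (Fin n) (Fin n) ℝ) (W : Set (Fin n → ℝ)) (hW : IsOpen W)
    (H : IGFrameSol V h L W) (x : Fin n → ℝ) (hx : x ∈ W) : FrameODE V h L x := by
  obtain ⟨hs, ho, h1, h2⟩ := H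
  intro m
  have hd : ∀ i k, DifferentiableAt ℝ (fun y => L y i k) x := fun i k =>
    ((hs i k).contDiffAt (hW.mem_nhds hx)).differentiableAt (by simp)
  have hoT : (L x)ᵀ * L x = 1 := mul_eq_one_comm.1 (ho x hx)
  have hoT' : ∀ a b, ∑ j, L x j a * L x j b = if a = b then 1 else 0 := by
    intro a b
    have := congrFun (congrFun hoT a) b
    rw [Matrix.mul_apply, Matrix.one_apply] at this
    simpa using this
  let T : Fin n → Fin n → ℝ := fun i j => (∑ k, pd m (fun y => L y i k) x * L x j k)
      + (∑ k, ∑ l, L x i k * bIG h x k l m * L x j l)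
  have hanti : ∀ i j, T i j + T j i = 0 := by
    intro i j
    have e1 : pd m (fun y => ∑ k, L y i k * L y j k) x = 0 := by
      have : (fun y => ∑ k, L y i k * L y j k) =ᶠ[nhds x] fun _ => (1 : Matrix (Fin n) (Fin n) ℝ) i j := by
        filter_upwards [hW.mem_nhds hx] with y hy
        rw [← ho y hy, Matrix.mul_apply]
        rfl
      rw [pd, this.fderiv_eq]
      simp
    rw [pd_sum _ _ _ _ (fun k _ => (hd i k).fun_mul (hd j k))] at e1
    simp only [pd_mul m _ _ x (hd _ _) (hd _ _), Finset.sum_add_distrib] at e1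
    have e2 : ∑ k, ∑ l, L x j k * bIG h x k l m * L x i l
        = - ∑ k, ∑ l, L x i k * bIG h x k l m * L x j l := by
      rw [Finset.sum_comm, ← Finset.sum_neg_distrib]
      refine Finset.sum_congr rfl fun k _ => ?_
      rw [← Finset.sum_neg_distrib]
      refine Finset.sum_congr rfl fun l _ => ?_
      rw [bIG_anti h x l k m]
      ring
    have e3 : ∑ k, pd m (fun y => L y j k) x * L x i k = ∑ k, L x i k * pd m (fun y => L y j k) x :=
      Finset.sum_congr rfl fun k _ => mul_comm _ _
    simp only [T]
    rw [e2, e3]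
    linarith
  have hT : ∀ i j, T i j = - (if i = 0 then L x j m * V x m else 0)
      + (if j = 0 then L x i m * V x m else 0) := by
    have hT0 : ∀ j, j ≠ 0 → T 0 j = - (L x j m * V x m) := fun j hj => by
      have := h1 x hx m j hj
      simp only [T]
      linarith
    intro i j
    by_cases hij : i = j
    · subst hij
      have := hanti i i
      split_ifs <;> linarith
    · by_cases hi : i = 0
      · subst hi
        have := hT0 j (Ne.symm hij)
        simp [Ne.symm hij, this]
      · by_cases hj : j = 0
        · subst hj
          have a1 := hT0 i hi
          have a2 := hanti i 0
          simp [hi]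
          linarith
        · simp [hi, hj]
          exact h2 x hx m i j hij hi hj
  intro i k
  have e1 : ∑ j, T i j * L x j k = pd m (fun y => L y i k) x + ∑ s, L x i s * bIG h x s k m := by
    have c1 : ∀ j, T i j * L x j k = (∑ a, pd m (fun y => L y i a) x * (L x j a * L x j k))
      + ∑ a, ∑ l, L x i a * bIG h x a l m * (L x j l * L x j k) := by
      intro j
      simp only [T, add_mul, Finset.sum_mul]
      congr 1
      · exact Finset.sum_congr rfl fun _ _ => by ring
      · exact Finset.sum_congr rfl fun _ _ => Finset.sum_congr rfl fun _ _ => by ring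
    simp only [c1]
    rw [Finset.sum_add_distrib, Finset.sum_comm]
    congr 1
    · simp only [← Finset.mul_sum, hoT']
      simp
    · rw [Finset.sum_comm]
      refine Finset.sum_congr rfl fun a _ => ?_
      rw [Finset.sum_comm]
      simp only [← Finset.mul_sum, hoT']
      simp
  have e2 : ∑ j, T i j * L x j k = - (if i = 0 then (if k = m then V x m else 0) else 0)
      + L x i m * V x m * L x 0 k := by
    have c2 : ∀ j, T i j * L x j k = - ((if i = 0 then V x m else 0) * (L x j m * L x j k))
        + (if j = 0 then L x i m * V x m * L x 0 k else 0) := by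
      intro j
      rw [hT]
      by_cases hj : j = 0
      · subst hj; split_ifs <;> ring
      · simp only [hj, if_false]; split_ifs <;> ring
    simp only [c2, Finset.sum_add_distrib, Finset.sum_neg_distrib, ← Finset.mul_sum, hoT']
    simp [eq_comm (a := k) (b := m)]
    split_ifs <;> simp
  linarith

lemma frame_uniq (V : (Fin n → ℝ) → Fin n → ℝ) (h : (Fin n → ℝ) → Fin n → Fin n → ℝ)
    (W : Set (Fin n → ℝ)) (hW : IsOpen W) (hWc : IsPreconnected W)
    (hV : ∀ i, ContDiffOn ℝ (⊤ : ℕ∞) (fun x => V x i) W)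
    (hh : ∀ i j, ContDiffOn ℝ (⊤ : ℕ∞) (fun x => h x i j) W)
    (L L' : (Fin n → ℝ) → Matrix (Fin n) (Fin n) ℝ)
    (H : IGFrameSol V h L W) (H' : IGFrameSol V h L' W)
    (x₀ : Fin n → ℝ) (hx₀ : x₀ ∈ W) (h0 : L x₀ = L' x₀) : ∀ x ∈ W, L x = L' x := by
  let M : (Fin n → ℝ) → Fin n → (Fin n × Fin n) → (Fin n × Fin n) → ℝ := fun x m a b =>
    (if b.1 = a.1 then - bIG h x b.2 a.2 m else 0)
    + (if b = (a.1, m) then V x m * L x 0 a.2 else 0)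
    + (if b = (0, a.2) then L' x a.1 m * V x m else 0)
  have hd : ∀ x ∈ W, ∀ i k, DifferentiableAt ℝ (fun y => L y i k) x := fun x hx i k =>
    ((H.1 i k).contDiffAt (hW.mem_nhds hx)).differentiableAt (by simp)
  have hd' : ∀ x ∈ W, ∀ i k, DifferentiableAt ℝ (fun y => L' y i k) x := fun x hx i k =>
    ((H'.1 i k).contDiffAt (hW.mem_nhds hx)).differentiableAt (by simp)
  have := coord_uniq M W hW hWc ?_ (fun x a => L x a.1 a.2 - L' x a.1 a.2)
    (fun x hx a => (hd x hx _ _).sub (hd' x hx _ _)) ?_ x₀ hx₀ (by ext a; simp [h0])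
  · intro x hx
    ext i k
    have := congrFun (this x hx) (i, k)
    simpa [sub_eq_zero] using this
  · intro m a b
    refine ContinuousOn.add (ContinuousOn.add ?_ ?_) ?_
    · split_ifs
      · exact (bIG_contDiffOn h W hh _ _ _).continuousOn.neg
      · exact continuousOn_const
    · split_ifs
      · exact (hV _).continuousOn.mul (H.1 _ _).continuousOn
      · exact continuousOn_const
    · split_ifs
      · exact (H'.1 _ _).continuousOn.mul (hV _).continuousOn
      · exact continuousOn_const
  · rintro x hx m ⟨i, k⟩
    rw [pd_sub m _ _ x (hd x hx _ _) (hd' x hx _ _), frameODE_of_sol V h L W hW H x hx,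
      frameODE_of_sol V h L' W hW H' x hx]
    simp only [M, add_mul, Finset.sum_add_distrib, ite_mul, zero_mul, Finset.sum_ite_eq',
      Finset.mem_univ, if_true]
    have e : ∑ b : Fin n × Fin n, (if b.1 = i then -bIG h x b.2 k m * (L x b.1 b.2 - L' x b.1 b.2) else 0)
      = - (∑ s, L x i s * bIG h x s k m) + ∑ s, L' x i s * bIG h x s k m := by
      rw [Fintype.sum_prod_type, Finset.sum_comm]
      simp only [Finset.sum_ite_eq', Finset.mem_univ, if_true]
      rw [← Finset.sum_neg_distrib, ← Finset.sum_add_distrib]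
      exact Finset.sum_congr rfl fun s _ => by ring
    rw [e]
    ring

lemma frame_exists (V : (Fin n → ℝ) → Fin n → ℝ) (h : (Fin n → ℝ) → Fin n → Fin n → ℝ)
    (U : Set (Fin n → ℝ)) (hU : IsOpen U)
    (hV : ∀ i, ContDiffOn ℝ (⊤ : ℕ∞) (fun x => V x i) U)
    (hh : ∀ i j, ContDiffOn ℝ (⊤ : ℕ∞) (fun x => h x i j) U)
    (hsol : IGSGE n U V h) (x₀ : Fin n → ℝ) (hx₀ : x₀ ∈ U) (L₀ : Matrix (Fin n) (Fin n) ℝ)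
    (hL₀ : L₀ * L₀ᵀ = 1) :
    ∃ W : Set (Fin n → ℝ), IsOpen W ∧ x₀ ∈ W ∧ W ⊆ U ∧
        ∃ L : (Fin n → ℝ) → Matrix (Fin n) (Fin n) ℝ,
          L x₀ = L₀ ∧ IGFrameSol V h L W := by
  obtain ⟨R, hR, hRU, H⟩ := frob_coord (MIG V h) U hU (MIG_contDiffOn V h U hV hh)
    (MIG_flat V h U hU hh hsol) x₀ hx₀
  choose Y hY0 hYs hYd using fun i : Fin n => H (fun a => a.elim (if i = 0 then 1 else 0) (L₀ i))
  let p : Fin n → Fin n → (Fin n → ℝ) → ℝ := fun i k x => Y i x (some k)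
  let q : Fin n → (Fin n → ℝ) → ℝ := fun i x => Y i x none
  have hp0 : ∀ i k, p i k x₀ = L₀ i k := fun i k => by simp [p, hY0]
  have hq0 : ∀ i, q i x₀ = if i = 0 then 1 else 0 := fun i => by simp [q, hY0]
  have hps : ∀ i k, ContDiffOn ℝ (⊤ : ℕ∞) (p i k) (Metric.ball x₀ R) := fun i k => hYs i (some k)
  have hqs : ∀ i, ContDiffOn ℝ (⊤ : ℕ∞) (q i) (Metric.ball x₀ R) := fun i => hYs i none
  have hpd : ∀ x ∈ Metric.ball x₀ R, ∀ i k, DifferentiableAt ℝ (p i k) x := fun x hx i k =>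
    ((hps i k).contDiffAt (Metric.isOpen_ball.mem_nhds hx)).differentiableAt (by simp)
  have hqd : ∀ x ∈ Metric.ball x₀ R, ∀ i, DifferentiableAt ℝ (q i) x := fun x hx i =>
    ((hqs i).contDiffAt (Metric.isOpen_ball.mem_nhds hx)).differentiableAt (by simp)
  have hp' : ∀ x ∈ Metric.ball x₀ R, ∀ m i k, pd m (p i k) x =
      - (∑ s, p i s x * bIG h x s k m) - (if k = m then q i x * V x m else 0) := by
    intro x hx m i k
    have := hYd i x hx m (some k)
    rw [Fintype.sum_option] at this
    simp only [MIG] at this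
    refine this.trans ?_
    have e : ∑ s, -bIG h x s k m * Y i x (some s) = - ∑ s, p i s x * bIG h x s k m := by
      rw [← Finset.sum_neg_distrib]
      exact Finset.sum_congr rfl fun s _ => by simp only [p]; ring
    rw [e]
    simp only [q]
    split_ifs <;> ring
  have hq' : ∀ x ∈ Metric.ball x₀ R, ∀ m i, pd m (q i) x = - (p i m x * V x m) := by
    intro x hx m i
    have := hYd i x hx m none
    rw [Fintype.sum_option] at this
    simp only [MIG] at this
    refine this.trans ?_
    simp [p]
    ring
  have hmink : ∀ x ∈ Metric.ball x₀ R, ∀ i j, ∑ k, p i k x * p j k x - q i x * q j x =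
      (if i = j then 1 else 0) - (if i = 0 then 1 else 0) * (if j = 0 then 1 else 0) := by
    intro x hx i j
    have hsd : ∀ y ∈ Metric.ball x₀ R, DifferentiableAt ℝ (fun y => ∑ k, p i k y * p j k y) y :=
      fun y hy => DifferentiableAt.fun_sum fun k _ => (hpd y hy i k).fun_mul (hpd y hy j k)
    have hmd : ∀ y ∈ Metric.ball x₀ R, DifferentiableAt ℝ (fun y => q i y * q j y) y :=
      fun y hy => (hqd y hy i).mul (hqd y hy j)
    have hc := Metric.isOpen_ball.is_const_of_fderiv_eq_zero (𝕜 := ℝ) (s := Metric.ball x₀ R)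
      (f := fun y => ∑ k, p i k y * p j k y - q i y * q j y) (convex_ball x₀ R).isPreconnected
      (fun y hy => ((hsd y hy).sub (hmd y hy)).differentiableWithinAt) (by
        intro y hy
        ext1 v
        rw [fderiv_eq_sum_pd]
        simp only [Pi.zero_apply, _root_.zero_apply]
        refine Finset.sum_eq_zero fun m _ => ?_
        rw [pd_sub m _ _ y (hsd y hy) (hmd y hy), pd_mul m _ _ y (hqd y hy i) (hqd y hy j),
          pd_sum _ _ _ _ (fun k _ => (hpd y hy i k).fun_mul (hpd y hy j k))]
        simp only [pd_mul m _ _ y (hpd y hy _ _) (hpd y hy _ _), hp' y hy, hq' y hy]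
        have e : ∀ k, (- (∑ s, p i s y * bIG h y s k m) - (if k = m then q i y * V y m else 0)) * p j k y
            + p i k y * (- (∑ s, p j s y * bIG h y s k m) - (if k = m then q j y * V y m else 0))
            = - (∑ s, p i s y * bIG h y s k m * p j k y) - (∑ s, p i k y * bIG h y s k m * p j s y)
              - (if k = m then q i y * V y m * p j m y + p i m y * (q j y * V y m) else 0) := by
          intro k
          have e1 : ∑ s, p i k y * bIG h y s k m * p j s y = p i k y * ∑ s, p j s y * bIG h y s k m := by
            rw [Finset.mul_sum]
            exact Finset.sum_congr rfl fun s _ => by ring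
          rw [← Finset.sum_mul, e1]
          by_cases c : k = m
          · subst c; simp only [if_true]; ring
          · simp only [c, if_false]; ring
        simp only [e, Finset.sum_sub_distrib, Finset.sum_neg_distrib, Finset.sum_ite_eq',
          Finset.mem_univ, if_true]
        have e2 : ∑ k, ∑ s, p i k y * bIG h y s k m * p j s y
            = - ∑ k, ∑ s, p i s y * bIG h y s k m * p j k y := by
          rw [Finset.sum_comm, ← Finset.sum_neg_distrib]
          refine Finset.sum_congr rfl fun k _ => ?_
          rw [← Finset.sum_neg_distrib]
          refine Finset.sum_congr rfl fun s _ => ?_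
          rw [bIG_anti h y k s m]
          ring
        rw [e2]
        ring) hx (Metric.mem_ball_self hR)
    refine hc.trans ?_
    simp only [hp0, hq0]
    congr 1
    have := congrFun (congrFun hL₀ i) j
    rw [Matrix.mul_apply, Matrix.one_apply] at this
    simpa using this
  let W : Set (Fin n → ℝ) := Metric.ball x₀ R ∩ q 0 ⁻¹' {0}ᶜ
  have hWo : IsOpen W := (hqs 0).continuousOn.isOpen_inter_preimage Metric.isOpen_ball isOpen_compl_singleton
  have hWb : W ⊆ Metric.ball x₀ R := Set.inter_subset_left
  have hqne : ∀ x ∈ W, q 0 x ≠ 0 := fun x hx => hx.2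
  let L : (Fin n → ℝ) → Matrix (Fin n) (Fin n) ℝ := fun x i k =>
    if i = 0 then p 0 k x / q 0 x else p i k x - q i x * (p 0 k x / q 0 x)
  have hLz : ∀ x k, L x 0 k = p 0 k x / q 0 x := fun x k => by simp [L]
  have hLs : ∀ x i, i ≠ 0 → ∀ k, L x i k = p i k x - q i x * (p 0 k x / q 0 x) :=
    fun x i hi k => by simp [L, hi]
  have hsm : ∀ i k, ContDiffOn ℝ (⊤ : ℕ∞) (fun x => L x i k) W := by
    intro i k
    have h0 : ContDiffOn ℝ (⊤ : ℕ∞) (fun x => p 0 k x / q 0 x) W :=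
      ((hps 0 k).mono hWb).div ((hqs 0).mono hWb) hqne
    by_cases hi : i = 0
    · subst hi; simp only [hLz]; exact h0
    · simp only [hLs _ i hi]
      exact ((hps i k).mono hWb).sub (((hqs i).mono hWb).mul h0)
  have horth : ∀ x ∈ W, L x * (L x)ᵀ = 1 := by
    intro x hx
    have hq := hqne x hx
    have m00 := hmink x (hWb hx) 0 0
    have e00 : ∑ k, p 0 k x * p 0 k x = q 0 x * q 0 x := by simp at m00; linarith
    have e0 : ∀ i, ∑ k, p i k x * p 0 k x = q i x * q 0 x := by
      intro i
      have := hmink x (hWb hx) i 0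
      by_cases hi : i = 0 <;> simp [hi] at this ⊢ <;> linarith
    have g0 : ∀ i, ∑ k, L x i k * L x 0 k = if i = 0 then 1 else 0 := by
      intro i
      by_cases hi : i = 0
      · subst hi
        simp only [hLz, if_true]
        have : ∀ k, p 0 k x / q 0 x * (p 0 k x / q 0 x) = (p 0 k x * p 0 k x) / (q 0 x * q 0 x) :=
          fun k => by field_simp
        simp only [this]
        rw [← Finset.sum_div, e00]
        field_simp
      · simp only [hLz, hLs _ i hi, hi, if_false]
        have : ∀ k, (p i k x - q i x * (p 0 k x / q 0 x)) * (p 0 k x / q 0 x)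
          = (p i k x * p 0 k x) / q 0 x - (p 0 k x * p 0 k x) * (q i x / (q 0 x * q 0 x)) :=
          fun k => by field_simp
        simp only [this, Finset.sum_sub_distrib]
        rw [← Finset.sum_div, ← Finset.sum_mul, e00, e0]
        field_simp
        ring
    ext i j
    rw [Matrix.mul_apply, Matrix.one_apply]
    simp only [Matrix.transpose_apply]
    by_cases hj : j = 0
    · subst hj; exact g0 i
    · by_cases hi : i = 0
      · subst hi
        simp only [Ne.symm hj, if_false]
        have := g0 j
        simp only [hj, if_false] at this
        rw [← this]
        exact Finset.sum_congr rfl fun k _ => mul_comm _ _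
      · simp only [hLs _ i hi, hLs _ j hj]
        have : ∀ k, (p i k x - q i x * (p 0 k x / q 0 x)) * (p j k x - q j x * (p 0 k x / q 0 x))
          = p i k x * p j k x - (p i k x * p 0 k x) * (q j x / q 0 x) - (p j k x * p 0 k x) * (q i x / q 0 x)
            + (p 0 k x * p 0 k x) * (q i x * q j x / (q 0 x * q 0 x)) :=
          fun k => by field_simp; ring
        simp only [this, Finset.sum_sub_distrib, Finset.sum_add_distrib]
        rw [← Finset.sum_mul, ← Finset.sum_mul, ← Finset.sum_mul, e00, e0, e0]
        have mij := hmink x (hWb hx) i j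
        simp only [hi, hj, if_false, mul_zero, sub_zero] at mij
        rw [← mij]
        field_simp
        ring
  have hODE : ∀ x ∈ W, FrameODE V h L x := by
    intro x hx m
    have hb := hWb hx
    have hq := hqne x hx
    have h0 : ∀ k, pd m (fun y => p 0 k y / q 0 y) x = - (∑ s, p 0 s x / q 0 x * bIG h x s k m)
        - (if k = m then V x m else 0) + p 0 m x / q 0 x * V x m * (p 0 k x / q 0 x) := by
      intro k
      rw [pd_div m _ _ x (hpd x hb 0 k) (hqd x hb 0) hq, hp' x hb, hq' x hb]
      have : ∑ s, p 0 s x / q 0 x * bIG h x s k m = (∑ s, p 0 s x * bIG h x s k m) / q 0 x := by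
        rw [Finset.sum_div]
        exact Finset.sum_congr rfl fun s _ => by ring
      rw [this]
      split_ifs <;> field_simp <;> ring
    intro i k
    by_cases hi : i = 0
    · subst hi
      simp only [hLz, if_true]
      exact h0 k
    · simp only [hLs _ i hi, hLz, hi, if_false]
      have hdd : DifferentiableAt ℝ (fun y => p 0 k y / q 0 y) x := diff_div _ _ x (hpd x hb 0 k) (hqd x hb 0) hq
      rw [pd_sub m _ _ x (hpd x hb i k) ((hqd x hb i).fun_mul hdd), pd_mul m _ _ x (hqd x hb i) hdd,
        h0, hp' x hb, hq' x hb]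
      have : ∑ s, (p i s x - q i x * (p 0 s x / q 0 x)) * bIG h x s k m
          = (∑ s, p i s x * bIG h x s k m) - q i x * ∑ s, p 0 s x / q 0 x * bIG h x s k m := by
        rw [Finset.mul_sum, ← Finset.sum_sub_distrib]
        exact Finset.sum_congr rfl fun s _ => by ring
      rw [this]
      split_ifs <;> ring
  refine ⟨W, hWo, ⟨Metric.mem_ball_self hR, by simp [hq0]⟩, hWb.trans hRU, L, ?_, hsm, horth, ?_, ?_⟩
  · ext i k
    by_cases hi : i = 0
    · subst hi; simp [hLz, hp0, hq0]
    · simp [hLs _ i hi, hp0, hq0, hi]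
  · intro x hx m i hi
    have := (hODE x hx).sum_eq (horth x hx) m 0 i hi
    rw [this]
    simp
  · intro x hx m i j hij hi hj
    have := (hODE x hx).sum_eq (horth x hx) m i j hj
    rw [this]
    simp [hi]
end frame

theorem statement16 (n : ℕ) (hn : 2 ≤ n) [NeZero n]
    (U : Set (Fin n → ℝ)) (hU : IsOpen U)
    (V : (Fin n → ℝ) → Fin n → ℝ) (h : (Fin n → ℝ) → Fin n → Fin n → ℝ)
    (hV : ∀ i, ContDiffOn ℝ (⊤ : ℕ∞) (fun x => V x i) U)
    (hh : ∀ i j, ContDiffOn ℝ (⊤ : ℕ∞) (fun x => h x i j) U)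
    (hsol : IGSGE n U V h)
    (hVne : ∀ x ∈ U, ∀ i, V x i ≠ 0) :
    ∀ x₀ ∈ U, ∀ L₀ : Matrix (Fin n) (Fin n) ℝ, L₀ * L₀ᵀ = 1 →
      (∃ W : Set (Fin n → ℝ), IsOpen W ∧ x₀ ∈ W ∧ W ⊆ U ∧
        ∃ L : (Fin n → ℝ) → Matrix (Fin n) (Fin n) ℝ,
          L x₀ = L₀ ∧ IGFrameSol V h L W) ∧
      (∀ W : Set (Fin n → ℝ), IsOpen W → IsConnected W → x₀ ∈ W → W ⊆ U →
        ∀ L L' : (Fin n → ℝ) → Matrix (Fin n) (Fin n) ℝ,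
          IGFrameSol V h L W → IGFrameSol V h L' W → L x₀ = L' x₀ →
          ∀ x ∈ W, L x = L' x) := by
  intro x₀ hx₀ L₀ hL₀
  refine ⟨frame_exists V h U hU hV hh hsol x₀ hx₀ L₀ hL₀, ?_⟩
  intro W hW hWc hxW hWU L L' H H' h0
  exact frame_uniq V h W hW hWc.isPreconnected (fun i => (hV i).mono hWU)
    (fun i j => (hh i j).mono hWU) L L' H H' x₀ hxW h0
end
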